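/- arXiv:1803.00644 — 6 statements merged into one kernel-verified Lean document; each statement's English description precedes it below -/
import Mathlib

section
/- Let f : S¹ → S¹ be a continuous map and let E ⊆ S¹ be a connected open set with E ⊆ R(f). Then either E ⊆ R₊(f) or E ⊆ R₋(f). -/
open Set Topology

/-- The circle `S¹ = ℝ / ℤ`. -/
abbrev Circle1 : Type := AddCircle (1 : ℝ)

/-- A point `x ∈ S¹` is a *regular point* of `f : S¹ → S¹` if there is a connected
open set `N ⊆ S¹` with `x ∈ N` such that the restriction of `f` to `N` is a
topological embedding. -/
def IsRegularPt (f : Circle1 → Circle1) (x : Circle1) : Prop :=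
  ∃ N : Set Circle1, IsOpen N ∧ IsConnected N ∧ x ∈ N ∧ Topology.IsEmbedding (N.restrict f)

/-- `R(f)`, the set of regular points of `f`. -/
def RegularPts (f : Circle1 → Circle1) : Set Circle1 := {x | IsRegularPt f x}

/-- `S(f) = S¹ \ R(f)`, the set of singular points of `f`. -/
def SingularPts (f : Circle1 → Circle1) : Set Circle1 := univ \ RegularPts f

/-- `f` is *increasing at* `x`: `x` is a regular point, and there exist `a ∈ ℝ` with
`π a = x`, `ε > 0`, and a continuous `g : ℝ → ℝ` strictly increasing on `(a-ε, a+ε)`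
with `f (π t) = π (g t)` for all `t ∈ (a-ε, a+ε)`. -/
def IncreasingAt (f : Circle1 → Circle1) (x : Circle1) : Prop :=
  IsRegularPt f x ∧ ∃ a : ℝ, (a : Circle1) = x ∧ ∃ ε : ℝ, 0 < ε ∧ ∃ g : ℝ → ℝ,
    Continuous g ∧ StrictMonoOn g (Ioo (a - ε) (a + ε)) ∧
    ∀ t ∈ Ioo (a - ε) (a + ε), f (t : Circle1) = ((g t : ℝ) : Circle1)

/-- `f` is *decreasing at* `x`: as `IncreasingAt`, with `g` strictly decreasing. -/
def DecreasingAt (f : Circle1 → Circle1) (x : Circle1) : Prop :=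
  IsRegularPt f x ∧ ∃ a : ℝ, (a : Circle1) = x ∧ ∃ ε : ℝ, 0 < ε ∧ ∃ g : ℝ → ℝ,
    Continuous g ∧ StrictAntiOn g (Ioo (a - ε) (a + ε)) ∧
    ∀ t ∈ Ioo (a - ε) (a + ε), f (t : Circle1) = ((g t : ℝ) : Circle1)

/-- `R₊(f)`, the set of points at which `f` is increasing. -/
def RPlus (f : Circle1 → Circle1) : Set Circle1 := {x | IncreasingAt f x}

/-- `R₋(f)`, the set of points at which `f` is decreasing. -/
def RMinus (f : Circle1 → Circle1) : Set Circle1 := {x | DecreasingAt f x}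

/-- `f` has a *local maximum* at `x`: there are `a ∈ ℝ` with `π a = x` and
`ε ∈ (0, 1/2)` such that `π '' (a-ε, a) ⊆ R₊(f)` and `π '' (a, a+ε) ⊆ R₋(f)`. -/
def HasLocalMaxAt (f : Circle1 → Circle1) (x : Circle1) : Prop :=
  ∃ a : ℝ, (a : Circle1) = x ∧ ∃ ε ∈ Ioo (0 : ℝ) (1 / 2),
    (fun t : ℝ => ((t : ℝ) : Circle1)) '' Ioo (a - ε) a ⊆ RPlus f ∧
    (fun t : ℝ => ((t : ℝ) : Circle1)) '' Ioo a (a + ε) ⊆ RMinus f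

/-- `f` has a *local minimum* at `x`: there are `a ∈ ℝ` with `π a = x` and
`ε ∈ (0, 1/2)` such that `π '' (a-ε, a) ⊆ R₋(f)` and `π '' (a, a+ε) ⊆ R₊(f)`. -/
def HasLocalMinAt (f : Circle1 → Circle1) (x : Circle1) : Prop :=
  ∃ a : ℝ, (a : Circle1) = x ∧ ∃ ε ∈ Ioo (0 : ℝ) (1 / 2),
    (fun t : ℝ => ((t : ℝ) : Circle1)) '' Ioo (a - ε) a ⊆ RMinus f ∧
    (fun t : ℝ => ((t : ℝ) : Circle1)) '' Ioo a (a + ε) ⊆ RPlus f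

/-- A continuous self-map of the circle lifts to the line. -/
theorem exists_continuous_lift {f : Circle1 → Circle1} (hf : Continuous f) :
    ∃ G : ℝ → ℝ, Continuous G ∧ ∀ t : ℝ, f (t : Circle1) = ((G t : ℝ) : Circle1) := by
  obtain ⟨e, he⟩ := QuotientAddGroup.mk_surjective (f ((0 : ℝ) : Circle1))
  obtain ⟨G, ⟨-, hG⟩, -⟩ := (AddCircle.isCoveringMap_coe (1 : ℝ)).existsUnique_continuousMap_lifts
    (⟨fun t : ℝ => f (t : Circle1), hf.comp (AddCircle.continuous_mk' 1)⟩ : C(ℝ, Circle1)) 0 e he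
  exact ⟨G, G.continuous, fun t => (congrFun hG t).symm⟩

/-- Around two points with the same image in the circle, a lift of a circle map takes the same
values up to an additive constant. -/
theorem lift_add_eq_of_coe_eq {f : Circle1 → Circle1} {G : ℝ → ℝ} (hG : Continuous G)
    (hlift : ∀ t : ℝ, f (t : Circle1) = ((G t : ℝ) : Circle1)) {a b : ℝ}
    (hab : (a : Circle1) = (b : Circle1)) (s : ℝ) :
    G (a + s) = G (b + s) + (G a - G b) := by
  refine congrFun ((AddCircle.isCoveringMap_coe (1 : ℝ)).eq_of_comp_eq
    (g₁ := fun s => G (a + s)) (g₂ := fun s => G (b + s) + (G a - G b))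
    (by fun_prop) (by fun_prop) (funext fun s => ?_) 0 (by simp)) s
  simp only [Function.comp_apply, AddCircle.coe_add, AddCircle.coe_sub, ← hlift, hab]
  abel

/-- A lift of a circle map is injective on an interval around each point above a regular point. -/
theorem IsRegularPt.exists_injOn_lift {f : Circle1 → Circle1} {G : ℝ → ℝ}
    (hlift : ∀ t : ℝ, f (t : Circle1) = ((G t : ℝ) : Circle1)) {a : ℝ}
    (ha : IsRegularPt f (a : Circle1)) :
    ∃ ε > 0, InjOn G (Ioo (a - ε) (a + ε)) := by
  obtain ⟨N, hNo, -, haN, hN⟩ := ha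
  obtain ⟨δ, hδ, hball⟩ := Metric.isOpen_iff.1
    (hNo.preimage (AddCircle.continuous_mk' (1 : ℝ))) a haN
  rw [Real.ball_eq_Ioo] at hball
  refine ⟨min δ (1 / 2), by positivity, fun s hs t ht hst => ?_⟩
  have hmem : ∀ {u}, u ∈ Ioo (a - min δ (1 / 2)) (a + min δ (1 / 2)) →
      (u : Circle1) ∈ N ∧ u ∈ Ico (a - 1 / 2) (a - 1 / 2 + 1) := fun {u} hu => by
    have h₁ := min_le_left δ (1 / 2)
    have h₂ := min_le_right δ (1 / 2)
    exact ⟨hball ⟨by linarith [hu.1], by linarith [hu.2]⟩,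
      by linarith [hu.1], by linarith [hu.2]⟩
  refine (AddCircle.coe_eq_coe_iff_of_mem_Ico (hmem hs).2 (hmem ht).2).1 ?_
  refine injOn_iff_injective.2 hN.injective (hmem hs).1 (hmem ht).1 ?_
  rw [hlift, hlift, hst]

/-- If `f : S¹ → S¹` is continuous and `E ⊆ S¹` is a connected open set consisting of
regular points of `f`, then either `E ⊆ R₊(f)` or `E ⊆ R₋(f)`. -/
theorem subset_RPlus_or_subset_RMinus (f : Circle1 → Circle1) (hf : Continuous f)
    (E : Set Circle1) (hEopen : IsOpen E) (hEconn : IsConnected E)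
    (hEreg : E ⊆ RegularPts f) :
    E ⊆ RPlus f ∨ E ⊆ RMinus f := by
  obtain ⟨G, hG, hlift⟩ := exists_continuous_lift hf
  let U : Set ℝ := ⋃₀ {V | IsOpen V ∧ StrictMonoOn G V}
  let W : Set ℝ := ⋃₀ {V | IsOpen V ∧ StrictAntiOn G V}
  have hUo : IsOpen U := isOpen_sUnion fun V hV => hV.1
  have hWo : IsOpen W := isOpen_sUnion fun V hV => hV.1
  have hdisj : Disjoint (((↑) : ℝ → Circle1) '' U) (((↑) : ℝ → Circle1) '' W) := by
    rw [Set.disjoint_left]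
    rintro _ ⟨a, ⟨V, ⟨hVo, hV⟩, haV⟩, rfl⟩ ⟨b, ⟨V', ⟨hVo', hV'⟩, hbV'⟩, hba⟩
    have hnear : ∀ᶠ s in 𝓝[>] (0 : ℝ), a + s ∈ V ∧ b + s ∈ V' :=
      nhdsWithin_le_nhds <| Filter.inter_mem
        ((hVo.preimage (continuous_const_add a)).mem_nhds (by simpa using haV))
        ((hVo'.preimage (continuous_const_add b)).mem_nhds (by simpa using hbV'))
    obtain ⟨s, ⟨has, hbs⟩, hs⟩ := (hnear.and self_mem_nhdsWithin).exists
    have hs : 0 < s := hs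
    linarith [hV haV has (by linarith), hV' hbV' hbs (by linarith),
      lift_add_eq_of_coe_eq hG hlift hba.symm s]
  have hcover : E ⊆ ((↑) : ℝ → Circle1) '' U ∪ ((↑) : ℝ → Circle1) '' W := by
    intro x hx
    obtain ⟨a, rfl⟩ := QuotientAddGroup.mk_surjective x
    obtain ⟨ε, hε, hinj⟩ := IsRegularPt.exists_injOn_lift hlift (hEreg hx)
    have ha : a ∈ Ioo (a - ε) (a + ε) := ⟨by linarith, by linarith⟩
    rcases hG.continuousOn.strictMonoOn_of_injOn_Ioo (ha.1.trans ha.2) hinj with h | h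
    · exact Or.inl ⟨a, ⟨_, ⟨isOpen_Ioo, h⟩, ha⟩, rfl⟩
    · exact Or.inr ⟨a, ⟨_, ⟨isOpen_Ioo, h⟩, ha⟩, rfl⟩
  refine (hEconn.isPreconnected.subset_or_subset (QuotientAddGroup.isOpenMap_coe U hUo)
    (QuotientAddGroup.isOpenMap_coe W hWo) hdisj hcover).imp (fun h x hx => ?_) (fun h x hx => ?_)
  all_goals
    obtain ⟨a, ⟨V, ⟨hVo, hV⟩, haV⟩, hax⟩ := h hx
    obtain ⟨ε, hε, hball⟩ := Metric.isOpen_iff.1 hVo a haV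
    rw [Real.ball_eq_Ioo] at hball
    exact ⟨hEreg hx, a, hax, ε, hε, G, hG, hV.mono hball, fun t _ => hlift t⟩
end

section
/- Let f : S¹ → S¹ be a continuous map and let E ⊆ S¹ be a connected open set with E ⊆ R(f). If the image f '' E is a proper subset of S¹, then the restriction of f to E is a topological embedding. -/
open Set Topology

open Filter

/-- A continuous injective real function near `c` is open at `c`. -/
theorem nhds_le_map_nhds_of_continuousOn_of_injOn {h : ℝ → ℝ} {c : ℝ} {V : Set ℝ}
    (hV : V ∈ 𝓝 c) (hcont : ContinuousOn h V) (hinj : InjOn h V) :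
    𝓝 (h c) ≤ map h (𝓝 c) := by
  intro s hs
  obtain ⟨δ, hδ, hsub⟩ := Metric.nhds_basis_closedBall.mem_iff.1 (inter_mem (mem_map.1 hs) hV)
  rw [Real.closedBall_eq_Icc] at hsub
  have hsV : Icc (c - δ) (c + δ) ⊆ V := fun x hx => (hsub hx).2
  have himage : h '' Icc (c - δ) (c + δ) ⊆ s := image_subset_iff.2 fun x hx => (hsub hx).1
  have hle : c - δ ≤ c + δ := by linarith
  have hl : c - δ ∈ Icc (c - δ) (c + δ) := left_mem_Icc.2 hle
  have hr : c + δ ∈ Icc (c - δ) (c + δ) := right_mem_Icc.2 hle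
  have hm : c ∈ Icc (c - δ) (c + δ) := ⟨by linarith, by linarith⟩
  have hlc : c - δ < c := by linarith
  have hcr : c < c + δ := by linarith
  rcases (hcont.mono hsV).strictMonoOn_of_injOn_Icc' hle (hinj.mono hsV) with hmono | hanti
  · exact mem_of_superset (Icc_mem_nhds (hmono hl hm hlc) (hmono hm hr hcr))
      ((intermediate_value_Icc hle (hcont.mono hsV)).trans himage)
  · exact mem_of_superset (Icc_mem_nhds (hanti hm hr hcr) (hanti hl hm hlc))
      ((intermediate_value_Icc' hle (hcont.mono hsV)).trans himage)

/-- A real function with a local extremum at `c` is not open at `c`. -/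
theorem IsLocalExtr.not_nhds_le_map_nhds {h : ℝ → ℝ} {c : ℝ} (hc : IsLocalExtr h c) :
    ¬ 𝓝 (h c) ≤ map h (𝓝 c) := by
  intro hle
  rcases hc with hc | hc
  · have hev : ∀ᶠ y in 𝓝 (h c), h c ≤ y := hle hc
    obtain ⟨y, hy, hlt⟩ := ((hev.filter_mono nhdsWithin_le_nhds).and
      (self_mem_nhdsWithin (s := Iio (h c)))).exists
    exact absurd hlt (not_lt.2 hy)
  · have hev : ∀ᶠ y in 𝓝 (h c), y ≤ h c := hle hc
    obtain ⟨y, hy, hlt⟩ := ((hev.filter_mono nhdsWithin_le_nhds).and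
      (self_mem_nhdsWithin (s := Ioi (h c)))).exists
    exact absurd hlt (not_lt.2 hy)

/-- Two distinct points of a connected subset of the circle are the endpoints of an arc contained
in that subset. -/
theorem exists_Icc_lift_subset {E : Set Circle1} (hE : IsPreconnected E) {x y : Circle1}
    (hx : x ∈ E) (hy : y ∈ E) (hxy : x ≠ y) :
    ∃ a b : ℝ, a < b ∧ (∀ t ∈ Icc a b, (t : Circle1) ∈ E) ∧
      (((a : Circle1) = x ∧ (b : Circle1) = y) ∨ ((a : Circle1) = y ∧ (b : Circle1) = x)) := by
  obtain ⟨a, rfl⟩ := QuotientAddGroup.mk_surjective x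
  obtain ⟨b, hb, rfl⟩ : y ∈ ((↑) : ℝ → Circle1) '' Ico a (a + 1) := by
    rw [AddCircle.coe_image_Ico_eq]; trivial
  have hab : a < b := lt_of_le_of_ne hb.1 fun h => hxy (congrArg _ h)
  have ha1 : ((a + 1 : ℝ) : Circle1) = a := AddCircle.coe_add_period 1 a
  by_cases h₁ : ∀ t ∈ Icc a b, (t : Circle1) ∈ E
  · exact ⟨a, b, hab, h₁, Or.inl ⟨rfl, rfl⟩⟩
  by_cases h₂ : ∀ t ∈ Icc b (a + 1), (t : Circle1) ∈ E
  · exact ⟨b, a + 1, hb.2, h₂, Or.inr ⟨rfl, ha1⟩⟩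
  push Not at h₁ h₂
  obtain ⟨u, hu, huE⟩ := h₁
  obtain ⟨v, hv, hvE⟩ := h₂
  have hau : a < u := lt_of_le_of_ne hu.1 fun h => huE (h ▸ hx)
  have hub : u < b := lt_of_le_of_ne hu.2 fun h => huE (h ▸ hy)
  have hbv : b < v := lt_of_le_of_ne hv.1 fun h => hvE (h ▸ hy)
  have hva : v < a + 1 := lt_of_le_of_ne hv.2 fun h => hvE (by rw [h, ha1]; exact hx)
  have hopen : IsOpenMap ((↑) : ℝ → Circle1) := QuotientAddGroup.isOpenMap_coe
  have hcover : E ⊆ ((↑) : ℝ → Circle1) '' Ioo u v ∪ ((↑) : ℝ → Circle1) '' Ioo v (u + 1) := by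
    intro z hz
    obtain ⟨t, ht, rfl⟩ : z ∈ ((↑) : ℝ → Circle1) '' Ico u (u + 1) := by
      rw [AddCircle.coe_image_Ico_eq]; trivial
    have hut : u < t := lt_of_le_of_ne ht.1 fun h => huE (h ▸ hz)
    rcases lt_trichotomy t v with h | h | h
    · exact Or.inl ⟨t, ⟨hut, h⟩, rfl⟩
    · exact absurd (h ▸ hz) hvE
    · exact Or.inr ⟨t, ⟨h, ht.2⟩, rfl⟩
  obtain ⟨z, -, ⟨s, hs, rfl⟩, ⟨t, ht, hst⟩⟩ := hE _ _ (hopen _ isOpen_Ioo) (hopen _ isOpen_Ioo)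
    hcover ⟨_, hy, b, ⟨hub, hbv⟩, rfl⟩ ⟨_, hx, a + 1, ⟨hva, by linarith⟩, ha1⟩
  have := (AddCircle.coe_eq_coe_iff_of_mem_Ico (p := (1 : ℝ)) (a := u)
    ⟨by linarith [ht.1, hs.1, hs.2], ht.2⟩ ⟨hs.1.le, by linarith [hs.2]⟩).1 hst
  linarith [ht.1, hs.2]

/-- If `f : S¹ → S¹` is continuous, `E ⊆ S¹` is a connected open set consisting of
regular points of `f`, and `f '' E` is a proper subset of `S¹`, then the restriction
of `f` to `E` is a topological embedding. -/
theorem isEmbedding_restrict_of_proper_image (f : Circle1 → Circle1) (hf : Continuous f)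
    (E : Set Circle1) (hEopen : IsOpen E) (hEconn : IsConnected E)
    (hEreg : E ⊆ RegularPts f) (hproper : f '' E ≠ univ) :
    Topology.IsEmbedding (E.restrict f) := by
  obtain ⟨p, hp⟩ := (ne_univ_iff_exists_notMem _).1 hproper
  obtain ⟨p, rfl⟩ := QuotientAddGroup.mk_surjective p
  let e := AddCircle.openPartialHomeomorphCoe (1 : ℝ) p
  have htarget : ∀ z ∈ E, f z ∈ e.target := fun z hz hzp => hp ⟨z, hz, hzp⟩
  let h : ℝ → ℝ := fun t => e.symm (f t)
  have hquot : Continuous ((↑) : ℝ → Circle1) := AddCircle.continuous_mk' 1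
  have hopen : IsOpenMap ((↑) : ℝ → Circle1) := QuotientAddGroup.isOpenMap_coe
  have hh : ∀ t : ℝ, (t : Circle1) ∈ E → ((h t : ℝ) : Circle1) = f t := fun t ht =>
    e.right_inv (htarget _ ht)
  have hcont : ContinuousOn h ((↑) ⁻¹' E) :=
    e.continuousOn_symm.comp (hf.comp hquot).continuousOn fun t ht => htarget _ ht
  have hnhds : ∀ c : ℝ, (c : Circle1) ∈ E → 𝓝 (h c) ≤ map h (𝓝 c) := by
    intro c hc
    obtain ⟨N, hNopen, -, hcN, hN⟩ := hEreg hc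
    have hV : ((↑) ⁻¹' (N ∩ E)) ∩ Ioo (c - 1 / 2) (c + 1 / 2) ∈ 𝓝 c :=
      inter_mem (((hNopen.inter hEopen).preimage hquot).mem_nhds ⟨hcN, hc⟩)
        (Ioo_mem_nhds (by linarith) (by linarith))
    refine nhds_le_map_nhds_of_continuousOn_of_injOn hV
      (hcont.mono fun t ht => ht.1.2) fun s hs t ht hst => ?_
    have hfst : f s = f t := by rw [← hh s hs.1.2, ← hh t ht.1.2, hst]
    have hmk := injOn_iff_injective.2 hN.injective hs.1.1 ht.1.1 hfst
    exact (AddCircle.coe_eq_coe_iff_of_mem_Ico (p := (1 : ℝ)) (a := c - 1 / 2)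
      ⟨hs.2.1.le, by linarith [hs.2.2]⟩ ⟨ht.2.1.le, by linarith [ht.2.2]⟩).1 hmk
  have hinj : InjOn f E := by
    intro x hx y hy hxy
    by_contra hne
    obtain ⟨a, b, hab, harc, hends⟩ := exists_Icc_lift_subset hEconn.isPreconnected hx hy hne
    have hhab : h a = h b := by
      rcases hends with ⟨rfl, rfl⟩ | ⟨rfl, rfl⟩
      · exact congrArg e.symm hxy
      · exact congrArg e.symm hxy.symm
    obtain ⟨c, hc, hext⟩ := exists_isLocalExtr_Ioo hab
      (hcont.mono harc) hhab
    exact hext.not_nhds_le_map_nhds (hnhds c (harc c (Ioo_subset_Icc_self hc)))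
  refine (IsOpenEmbedding.of_continuous_injective_isOpenMap (hf.comp continuous_subtype_val)
    (injOn_iff_injective.1 hinj) (isOpenMap_iff_nhds_le.2 ?_)).isEmbedding
  rintro ⟨x, hx⟩
  obtain ⟨c, rfl⟩ := QuotientAddGroup.mk_surjective x
  have hev : (fun t : ℝ => ((h t : ℝ) : Circle1)) =ᶠ[𝓝 c] fun t : ℝ => f t := by
    filter_upwards [(hEopen.preimage hquot).mem_nhds hx] with t ht using hh t ht
  calc 𝓝 (f c) = 𝓝 ((h c : ℝ) : Circle1) := by rw [hh c hx]
    _ = map (↑) (𝓝 (h c)) := (hopen.map_nhds_eq hquot.continuousAt).symm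
    _ ≤ map (↑) (map h (𝓝 c)) := map_mono (hnhds c hx)
    _ = map (fun t : ℝ => f t) (𝓝 c) := by rw [map_map]; exact map_congr hev
    _ = map f (𝓝 (c : Circle1)) := by
      rw [← hopen.map_nhds_eq hquot.continuousAt, map_map]; rfl
    _ = map (E.domRestrict f) (𝓝 ⟨c, hx⟩) := by
      rw [← map_nhds_subtype_coe_eq_nhds hx (hEopen.mem_nhds hx), map_map]; rfl
end

section
/- Let f : S¹ → S¹ be a continuous map, let x ∈ S¹, and let E be an open neighborhood of x in S¹ such that either E \ {x} ⊆ R₊(f) or E \ {x} ⊆ R₋(f). Then x ∈ R(f). -/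
open Set Topology

lemma le_of_eventually_lt_right {G : ℝ → ℝ} {u v : ℝ} (huv : u ≤ v)
    (hG : ContinuousOn G (Icc u v))
    (hlt : ∀ s ∈ Ico u v, ∀ᶠ t in 𝓝[>] s, G s < G t) : G u ≤ G v := by
  have hclosed : IsClosed ({t | G u ≤ G t} ∩ Icc u v) := by
    rw [inter_comm]
    exact hG.preimage_isClosed_of_isClosed isClosed_Icc isClosed_Ici
  refine hclosed.Icc_subset_of_forall_mem_nhdsWithin (le_refl (G u)) (fun s hs => ?_)
    (right_mem_Icc.2 huv)
  filter_upwards [hlt s hs.2] with t ht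
  exact (show G u ≤ G s from hs.1).trans ht.le

lemma lt_of_eventually_lt_right {G : ℝ → ℝ} {u v : ℝ} (huv : u < v)
    (hG : ContinuousOn G (Icc u v))
    (hlt : ∀ s ∈ Ico u v, ∀ᶠ t in 𝓝[>] s, G s < G t) : G u < G v := by
  obtain ⟨w, hw, hwu⟩ :=
    ((hlt u ⟨le_rfl, huv⟩).and (Ioo_mem_nhdsGT huv)).exists
  exact hw.trans_le (le_of_eventually_lt_right hwu.2.le
    (hG.mono (Icc_subset_Icc_left hwu.1.le))
    fun s hs => hlt s ⟨hwu.1.le.trans hs.1, hs.2⟩)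

/-- A continuous function which increases to the right of every point of an open interval,
except possibly one, is strictly increasing there. -/
lemma strictMonoOn_of_eventually_lt_right {G : ℝ → ℝ} {b a c : ℝ} (ha : a ∈ Ioo b c)
    (hG : ContinuousOn G (Ioo b c))
    (hlt : ∀ s ∈ Ioo b c, s ≠ a → ∀ᶠ t in 𝓝[>] s, G s < G t) :
    StrictMonoOn G (Ioo b c) := by
  have hcont {u v : ℝ} (hu : b < u) (hv : v < c) : ContinuousOn G (Icc u v) :=
    hG.mono fun t ht => ⟨hu.trans_le ht.1, ht.2.trans_lt hv⟩
  have hleft : StrictMonoOn G (Ioc b a) := fun u hu v hv huv =>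
    lt_of_eventually_lt_right huv (hcont hu.1 (hv.2.trans_lt ha.2)) fun s hs =>
      hlt s ⟨hu.1.trans_le hs.1, hs.2.trans_le (hv.2.trans ha.2.le)⟩ (hs.2.trans_le hv.2).ne
  have hright {u v : ℝ} (hu : a < u) (huv : u < v) (hv : v < c) : G u < G v :=
    lt_of_eventually_lt_right huv (hcont (ha.1.trans hu) hv) fun s hs =>
      hlt s ⟨(ha.1.trans hu).trans_le hs.1, hs.2.trans hv⟩ (hu.trans_le hs.1).ne'
  have hmono : StrictMonoOn G (Ico a c) := by
    intro u hu v hv huv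
    rcases hu.1.eq_or_lt with rfl | hau
    · obtain ⟨m, ham, hmv⟩ := exists_between huv
      have hlim : Filter.Tendsto G (𝓝[>] a) (𝓝 (G a)) :=
        (hG.continuousAt (isOpen_Ioo.mem_nhds ha)).tendsto.mono_left nhdsWithin_le_nhds
      refine lt_of_le_of_lt (le_of_tendsto hlim ?_) (hright ham hmv hv.2)
      filter_upwards [Ioo_mem_nhdsGT ham] with t ht
      exact (hright ht.1 ht.2 (hmv.trans hv.2)).le
    · exact hright hau huv hv.2
  rw [← Ioc_union_Ico_eq_Ioo ha.1 ha.2]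
  exact hleft.union hmono (isGreatest_Ioc ha.1) (isLeast_Ico ha.2)

/-- Two local lifts of the same map to the circle differ by a constant near a point. -/
lemma eventually_sub_eq_of_coe_eq {g h : ℝ → ℝ} {s : ℝ} (hg : ContinuousAt g s)
    (hh : ContinuousAt h s) (heq : ∀ᶠ t in 𝓝 s, (g t : Circle1) = (h t : Circle1)) :
    ∀ᶠ t in 𝓝 s, g t - h t = g s - h s := by
  have hint : ∀ t, (g t : Circle1) = (h t : Circle1) → ∃ n : ℤ, (n : ℝ) = g t - h t := by
    intro t ht
    have h0 : ((g t - h t : ℝ) : Circle1) = 0 := by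
      rw [AddCircle.coe_sub, ht, sub_self]
    simpa using (AddCircle.coe_eq_zero_iff (1 : ℝ)).1 h0
  obtain ⟨m, hm⟩ := hint s heq.self_of_nhds
  filter_upwards [heq, Metric.continuousAt_iff'.1 (hg.sub hh) 1 one_pos] with t ht hdist
  obtain ⟨n, hn⟩ := hint t ht
  rw [Pi.sub_apply, Pi.sub_apply, Real.dist_eq, ← hn, ← hm] at hdist
  rw [← hn, ← hm]
  have : |n - m| < 1 := by exact_mod_cast hdist
  rw [sub_eq_zero.1 (Int.abs_lt_one_iff.1 this)]

/-- Every continuous local lift of a map is increasing to the right of a point at which the map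
is increasing. -/
lemma IncreasingAt.eventually_lt_right {f : Circle1 → Circle1} {G : ℝ → ℝ} {s : ℝ}
    (hf : IncreasingAt f (s : Circle1)) (hG : ContinuousAt G s)
    (hlift : ∀ᶠ t in 𝓝 s, ((G t : ℝ) : Circle1) = f (t : Circle1)) :
    ∀ᶠ t in 𝓝[>] s, G s < G t := by
  obtain ⟨-, a, ha, ε, hε, g, hg, hmono, hgf⟩ := hf
  obtain ⟨n, hn⟩ : ∃ n : ℤ, (n : ℝ) = s - a := by
    have h0 : ((s - a : ℝ) : Circle1) = 0 := by rw [AddCircle.coe_sub, ha, sub_self]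
    simpa using (AddCircle.coe_eq_zero_iff (1 : ℝ)).1 h0
  have hshift (t : ℝ) : ((t - n : ℝ) : Circle1) = t := by
    rw [AddCircle.coe_sub, sub_eq_self]
    exact (AddCircle.coe_eq_zero_iff (1 : ℝ)).2 ⟨n, by simp⟩
  have hmem : ∀ t ∈ Ioo (s - ε) (s + ε), t - n ∈ Ioo (a - ε) (a + ε) := fun t ht =>
    ⟨by linarith [ht.1], by linarith [ht.2]⟩
  have hs : s ∈ Ioo (s - ε) (s + ε) := ⟨by linarith, by linarith⟩
  have hnhds : ∀ᶠ t in 𝓝 s, t ∈ Ioo (s - ε) (s + ε) := isOpen_Ioo.mem_nhds hs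
  have hconst := eventually_sub_eq_of_coe_eq (g := fun t => g (t - n)) (h := G)
    (by fun_prop) hG (by
      filter_upwards [hnhds, hlift] with t ht htG
      rw [htG, ← hgf _ (hmem t ht), hshift])
  filter_upwards [nhdsWithin_le_nhds hconst, nhdsWithin_le_nhds hnhds, self_mem_nhdsWithin]
    with t ht htε hst
  have := hmono (hmem s hs) (hmem t htε) (sub_lt_sub_right (mem_Ioi.1 hst) _)
  linarith

/-- A continuous map near a point of the circle has a continuous local lift. -/
lemma exists_local_lift {f : Circle1 → Circle1} (hf : Continuous f) (a : ℝ) :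
    ∃ G : ℝ → ℝ, ∃ U : Set ℝ, IsOpen U ∧ a ∈ U ∧ ContinuousOn G U ∧
      (∀ t ∈ U, ((G t : ℝ) : Circle1) = f (t : Circle1)) ∧
      ∀ s ∈ U, ∀ t ∈ U, f (s : Circle1) = f (t : Circle1) → G s = G t := by
  obtain ⟨c, hc⟩ := QuotientAddGroup.mk_surjective (f (a : Circle1))
  let e := AddCircle.openPartialHomeomorphCoe (1 : ℝ) (c - 1 / 2)
  have hfc : Continuous fun t : ℝ => f (t : Circle1) := hf.comp (AddCircle.continuous_mk' 1)
  refine ⟨fun t => e.symm (f (t : Circle1)), (fun t : ℝ => f (t : Circle1)) ⁻¹' e.target,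
    e.open_target.preimage hfc, ?_, ?_, fun t ht => e.right_inv ht, fun s _ t _ h => by
      simp only [h]⟩
  · rw [mem_preimage, ← hc]
    exact e.map_source (show c ∈ Ioo (c - 1 / 2) (c - 1 / 2 + 1) from
      ⟨by linarith, by linarith⟩)
  · exact e.continuousOn_symm.comp hfc.continuousOn fun t ht => ht

/-- A map that is injective on a small arc around a point is regular there. -/
lemma isRegularPt_of_injOn {f : Circle1 → Circle1} (hf : Continuous f) {a δ : ℝ} (hδ : 0 < δ)
    (hinj : InjOn (fun t : ℝ => f (t : Circle1)) (Ioo (a - δ) (a + δ))) :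
    IsRegularPt f (a : Circle1) := by
  have hπ : Continuous fun t : ℝ => (t : Circle1) := AddCircle.continuous_mk' 1
  set K : Set Circle1 := (fun t : ℝ => (t : Circle1)) '' Icc (a - δ / 2) (a + δ / 2)
  set N : Set Circle1 := (fun t : ℝ => (t : Circle1)) '' Ioo (a - δ / 2) (a + δ / 2)
  have hNK : N ⊆ K := image_mono Ioo_subset_Icc_self
  have hK : IsCompact K := isCompact_Icc.image hπ
  have : CompactSpace K := isCompact_iff_compactSpace.1 hK
  have hinjK : InjOn f K := by
    rintro _ ⟨s, hs, rfl⟩ _ ⟨t, ht, rfl⟩ hst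
    have hsub : Icc (a - δ / 2) (a + δ / 2) ⊆ Ioo (a - δ) (a + δ) :=
      Icc_subset_Ioo (by linarith) (by linarith)
    exact congrArg _ (hinj (hsub hs) (hsub ht) hst)
  have hemb : IsEmbedding (K.domRestrict f) :=
    ((hf.comp continuous_subtype_val).isClosedEmbedding hinjK.injective).isEmbedding
  have ha : a ∈ Ioo (a - δ / 2) (a + δ / 2) := ⟨by linarith, by linarith⟩
  exact ⟨N, QuotientAddGroup.isOpenMap_coe _ isOpen_Ioo,
    (isConnected_Ioo (ha.1.trans ha.2)).image _ hπ.continuousOn, mem_image_of_mem _ ha,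
    hemb.comp (IsEmbedding.inclusion hNK)⟩

lemma isRegularPt_of_punctured_nbhd_rPlus {f : Circle1 → Circle1} (hf : Continuous f)
    {x : Circle1} {E : Set Circle1} (hE : IsOpen E) (hxE : x ∈ E) (h : E \ {x} ⊆ RPlus f) :
    IsRegularPt f x := by
  obtain ⟨a, rfl⟩ := QuotientAddGroup.mk_surjective x
  obtain ⟨G, U, hU, haU, hG, hlift, hGinj⟩ := exists_local_lift hf a
  have hV : U ∩ (fun t : ℝ => (t : Circle1)) ⁻¹' E ∈ 𝓝 a :=
    (hU.inter (hE.preimage (AddCircle.continuous_mk' 1))).mem_nhds ⟨haU, hxE⟩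
  obtain ⟨r, hr, hrV⟩ := Metric.mem_nhds_iff.1 hV
  obtain ⟨δ, hδ, hδr, hδ1⟩ : ∃ δ > 0, δ ≤ r ∧ δ ≤ 1 / 2 :=
    ⟨min r (1 / 2), lt_min hr (by norm_num), min_le_left _ _, min_le_right _ _⟩
  have hsub : Ioo (a - δ) (a + δ) ⊆ U ∩ (fun t : ℝ => (t : Circle1)) ⁻¹' E := by
    rw [← Real.ball_eq_Ioo]
    exact (Metric.ball_subset_ball hδr).trans hrV
  have hmono : StrictMonoOn G (Ioo (a - δ) (a + δ)) := by
    have ha : a ∈ Ioo (a - δ) (a + δ) := ⟨by linarith, by linarith⟩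
    refine strictMonoOn_of_eventually_lt_right ha (hG.mono fun t ht => (hsub ht).1)
      fun s hs hsa => ?_
    have hsU := (hsub hs).1
    refine (h ⟨(hsub hs).2, fun hs_eq => hsa ?_⟩ :
      IncreasingAt f (s : Circle1)).eventually_lt_right
      (hG.continuousAt (hU.mem_nhds hsU)) ?_
    · have hIco : Ioo (a - δ) (a + δ) ⊆ Ico (a - δ) (a - δ + 1) := fun t ht =>
        ⟨ht.1.le, by linarith [ht.2]⟩
      exact (AddCircle.coe_eq_coe_iff_of_mem_Ico (hIco hs) (hIco ha)).1 hs_eq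
    · filter_upwards [hU.mem_nhds hsU] with t ht using hlift t ht
  exact isRegularPt_of_injOn hf hδ fun s hs t ht hst =>
    hmono.injOn hs ht (hGinj s (hsub hs).1 t (hsub ht).1 hst)

lemma IsRegularPt.neg {f : Circle1 → Circle1} {x : Circle1} (h : IsRegularPt f x) :
    IsRegularPt (fun y => -f y) x := by
  obtain ⟨N, hN, hNc, hx, hemb⟩ := h
  exact ⟨N, hN, hNc, hx, (Homeomorph.neg Circle1).isEmbedding.comp hemb⟩

lemma DecreasingAt.neg {f : Circle1 → Circle1} {x : Circle1} (h : DecreasingAt f x) :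
    IncreasingAt (fun y => -f y) x := by
  obtain ⟨hreg, a, ha, ε, hε, g, hg, hanti, hgf⟩ := h
  exact ⟨hreg.neg, a, ha, ε, hε, fun t => -g t, hg.neg, hanti.neg, fun t ht => by
    simp only [hgf t ht, AddCircle.coe_neg]⟩

/-- If `f : S¹ → S¹` is continuous, `x ∈ S¹`, and `E` is an open neighborhood of `x`
such that either `E \ {x} ⊆ R₊(f)` or `E \ {x} ⊆ R₋(f)`, then `x` is a regular point
of `f`. -/
theorem isRegularPt_of_punctured_nbhd (f : Circle1 → Circle1) (hf : Continuous f)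
    (x : Circle1) (E : Set Circle1) (hEopen : IsOpen E) (hxE : x ∈ E)
    (h : E \ {x} ⊆ RPlus f ∨ E \ {x} ⊆ RMinus f) :
    IsRegularPt f x := by
  rcases h with h | h
  · exact isRegularPt_of_punctured_nbhd_rPlus hf hEopen hxE h
  · simpa using (isRegularPt_of_punctured_nbhd_rPlus (f := fun y => -f y) hf.neg hEopen hxE
      fun y hy => (h hy).neg).neg
end

section
/- Let f : S¹ → S¹ be a continuous map such that every point of S(f) is an isolated point of S(f). Then S(f) is a finite set, and the (finite) number of points of S¹ at which f has a local maximum equals the (finite) number of points of S¹ at which f has a local minimum. -/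
open Set Topology

/-- Telescoping: if `L` and `R` record the one-sided limits of a locally constant integer-valued
function with finitely many jumps in `[0, 1)`, and `L 0 = L 1`, then the jumps sum to zero. -/
theorem sum_jump_eq_zero {L R : ℝ → ℤ} {T : Finset ℝ}
    (hL : ∀ t, ∀ᶠ u in 𝓝[<] t, L u = L t) (hR : ∀ t, ∀ᶠ u in 𝓝[>] t, L u = R t)
    (hT : ∀ t ∈ Ico (0 : ℝ) 1, L t ≠ R t → t ∈ T) (hT' : ∀ t ∈ T, t ∈ Ico (0 : ℝ) 1)
    (hper : L 0 = L 1) : ∑ t ∈ T, (L t - R t) = 0 := by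
  set G : ℝ → ℤ := fun t => L t + ∑ s ∈ T, if s < t then L s - R s else 0 with hG
  have hloc : ∀ t ∈ Icc (0 : ℝ) 1, ∀ᶠ u in 𝓝 t, u ∈ Icc (0 : ℝ) 1 → G u = G t := by
    intro t ht
    rw [← nhdsNE_sup_pure, ← nhdsLT_sup_nhdsGT, Filter.eventually_sup, Filter.eventually_sup]
    refine ⟨⟨?_, ?_⟩, fun _ => rfl⟩
    · have hlt : ∀ᶠ u in 𝓝[<] t, ∀ s ∈ T, s < t → s < u :=
        (Filter.eventually_all_finset T).2 fun s _ => by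
          by_cases h : s < t
          · filter_upwards [nhdsWithin_le_nhds (Ioi_mem_nhds h)] with u hu _ using hu
          · exact Filter.Eventually.of_forall fun u h' => absurd h' h
      filter_upwards [hL t, hlt, self_mem_nhdsWithin] with u hu hlt hut _
      have hut : u < t := hut
      simp only [hG, hu]
      congr 1
      refine Finset.sum_congr rfl fun s hs => ?_
      have : s < u ↔ s < t := ⟨fun h => h.trans hut, hlt s hs⟩
      simp [this]
    · have hgt : ∀ᶠ u in 𝓝[>] t, ∀ s ∈ T, t < s → u < s :=
        (Filter.eventually_all_finset T).2 fun s _ => by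
          by_cases h : t < s
          · filter_upwards [nhdsWithin_le_nhds (Iio_mem_nhds h)] with u hu _ using hu
          · exact Filter.Eventually.of_forall fun u h' => absurd h' h
      filter_upwards [hR t, hgt, self_mem_nhdsWithin] with u hu hgt htu hu1
      have htu : t < u := htu
      have htI : t ∈ Ico (0 : ℝ) 1 := ⟨ht.1, htu.trans_le hu1.2⟩
      have hsum : (∑ s ∈ T, if s < u then L s - R s else 0) =
          (∑ s ∈ T, if s < t then L s - R s else 0) +
            ∑ s ∈ T, if t = s then L s - R s else 0 := by
        rw [← Finset.sum_add_distrib]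
        refine Finset.sum_congr rfl fun s hs => ?_
        rcases lt_trichotomy s t with h | rfl | h
        · simp [h, h.trans htu, h.ne']
        · simp [htu]
        · simp [h.not_gt, (hgt s hs h).not_gt, h.ne]
      have hval : (if t ∈ T then L t - R t else 0) = L t - R t := by
        split_ifs with h
        · rfl
        · have := not_imp_comm.1 (hT t htI) h
          omega
      simp only [hG, hu, hsum, Finset.sum_ite_eq, hval]
      ring
  have hcont : ContinuousOn G (Icc 0 1) := fun t ht =>
    continuousWithinAt_const.congr_of_eventuallyEq
      (eventually_nhdsWithin_iff.2 (hloc t ht)) rfl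
  have h01 : G 0 = G 1 := isPreconnected_Icc.constant hcont (by simp) (by simp)
  have h0 : (∑ s ∈ T, if s < 0 then L s - R s else 0) = 0 :=
    Finset.sum_eq_zero fun s hs => if_neg (hT' s hs).1.not_gt
  have h1 : (∑ s ∈ T, if s < 1 then L s - R s else 0) = ∑ s ∈ T, (L s - R s) :=
    Finset.sum_congr rfl fun s hs => if_pos (hT' s hs).2
  simp only [hG, h0, h1, hper] at h01
  omega

theorem exists_Ioo_subset_of_eventually_nhdsNE {p : ℝ → Prop} {t : ℝ}
    (h : ∀ᶠ u in 𝓝[≠] t, p u) :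
    ∃ ε > 0, (∀ u ∈ Ioo (t - ε) t, p u) ∧ ∀ u ∈ Ioo t (t + ε), p u := by
  obtain ⟨ε, hε, h⟩ := Metric.eventually_nhds_iff.1 (eventually_nhdsWithin_iff.1 h)
  refine ⟨ε, hε, fun u hu => h ?_ hu.2.ne, fun u hu => h ?_ hu.1.ne'⟩ <;>
  · rw [Real.dist_eq, abs_lt]
    constructor <;> linarith [hu.1, hu.2]

/-- If disjoint open sets `A, B` cover a punctured neighbourhood of every real point, all of `ℝ`
but `T` in a period, and `A` has the same left germ at `0` and `1`, then the transitions from `A`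
to `B` in a period are as many as those from `B` to `A`. -/
theorem card_transition_eq_card_transition {A B : Set ℝ} {T : Finset ℝ}
    (hA : IsOpen A) (hB : IsOpen B) (hAB : Disjoint A B)
    (hcov : ∀ t, ∀ᶠ u in 𝓝[≠] t, u ∈ A ∪ B)
    (hT : ∀ t ∈ Ico (0 : ℝ) 1, t ∉ A ∪ B → t ∈ T) (hT' : ∀ t ∈ T, t ∈ Ico (0 : ℝ) 1)
    (hper : (∀ᶠ u in 𝓝[<] (0 : ℝ), u ∈ A) ↔ ∀ᶠ u in 𝓝[<] (1 : ℝ), u ∈ A) :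
    {t | t ∈ T ∧ (∀ᶠ u in 𝓝[<] t, u ∈ A) ∧ ∀ᶠ u in 𝓝[>] t, u ∈ B}.ncard =
      {t | t ∈ T ∧ (∀ᶠ u in 𝓝[<] t, u ∈ B) ∧ ∀ᶠ u in 𝓝[>] t, u ∈ A}.ncard := by
  classical
  have hleft : ∀ t, ∃ ε > 0, Ioo (t - ε) t ⊆ A ∨ Ioo (t - ε) t ⊆ B := fun t => by
    obtain ⟨ε, hε, h, -⟩ := exists_Ioo_subset_of_eventually_nhdsNE (hcov t)
    exact ⟨ε, hε, isPreconnected_Ioo.subset_or_subset hA hB hAB h⟩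
  have hright : ∀ t, ∃ ε > 0, Ioo t (t + ε) ⊆ A ∨ Ioo t (t + ε) ⊆ B := fun t => by
    obtain ⟨ε, hε, -, h⟩ := exists_Ioo_subset_of_eventually_nhdsNE (hcov t)
    exact ⟨ε, hε, isPreconnected_Ioo.subset_or_subset hA hB hAB h⟩
  have hlmem : ∀ {t ε : ℝ}, 0 < ε → Ioo (t - ε) t ∈ 𝓝[<] t := fun h =>
    Ioo_mem_nhdsLT (by linarith)
  have hrmem : ∀ {t ε : ℝ}, 0 < ε → Ioo t (t + ε) ∈ 𝓝[>] t := fun h =>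
    Ioo_mem_nhdsGT (by linarith)
  have hdisj : ∀ {l : Filter ℝ} [l.NeBot], (∀ᶠ u in l, u ∈ A) → (∀ᶠ u in l, u ∈ B) → False :=
    fun ha hb => by
      obtain ⟨u, hu⟩ := (ha.and hb).exists
      exact hAB.le_bot hu
  have hl : ∀ t, (∀ᶠ u in 𝓝[<] t, u ∈ B) ↔ ¬ ∀ᶠ u in 𝓝[<] t, u ∈ A := fun t => by
    refine ⟨fun hb ha => hdisj ha hb, fun ha => ?_⟩
    obtain ⟨ε, hε, h | h⟩ := hleft t
    · exact absurd (Filter.mem_of_superset (hlmem hε) h) ha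
    · exact Filter.mem_of_superset (hlmem hε) h
  have hr : ∀ t, (∀ᶠ u in 𝓝[>] t, u ∈ B) ↔ ¬ ∀ᶠ u in 𝓝[>] t, u ∈ A := fun t => by
    refine ⟨fun hb ha => hdisj ha hb, fun ha => ?_⟩
    obtain ⟨ε, hε, h | h⟩ := hright t
    · exact absurd (Filter.mem_of_superset (hrmem hε) h) ha
    · exact Filter.mem_of_superset (hrmem hε) h
  set L : ℝ → ℤ := fun t => if ∀ᶠ u in 𝓝[<] t, u ∈ A then 1 else 0 with hLdef
  set R : ℝ → ℤ := fun t => if ∀ᶠ u in 𝓝[>] t, u ∈ A then 1 else 0 with hRdef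
  have hLA : ∀ {u}, u ∈ A → L u = 1 ∧ R u = 1 := fun hu =>
    ⟨if_pos (nhdsWithin_le_nhds (hA.mem_nhds hu)), if_pos (nhdsWithin_le_nhds (hA.mem_nhds hu))⟩
  have hLB : ∀ {u}, u ∈ B → L u = 0 ∧ R u = 0 := fun {u} hu =>
    ⟨if_neg ((hl u).1 (nhdsWithin_le_nhds (hB.mem_nhds hu))),
      if_neg ((hr u).1 (nhdsWithin_le_nhds (hB.mem_nhds hu)))⟩
  have hsum := sum_jump_eq_zero (L := L) (R := R) (T := T)
    (fun t => by
      by_cases h : ∀ᶠ u in 𝓝[<] t, u ∈ A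
      · filter_upwards [h] with u hu
        rw [(hLA hu).1, hLdef]
        exact (if_pos h).symm
      · filter_upwards [(hl t).2 h] with u hu
        rw [(hLB hu).1, hLdef]
        exact (if_neg h).symm)
    (fun t => by
      by_cases h : ∀ᶠ u in 𝓝[>] t, u ∈ A
      · filter_upwards [h] with u hu
        rw [(hLA hu).1, hRdef]
        exact (if_pos h).symm
      · filter_upwards [(hr t).2 h] with u hu
        rw [(hLB hu).1, hRdef]
        exact (if_neg h).symm)
    (fun t ht hne => hT t ht fun h => hne <| by
      rcases h with h | h
      · rw [(hLA h).1, (hLA h).2]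
      · rw [(hLB h).1, (hLB h).2])
    hT' (by simp only [hLdef, hper])
  have hcard : ∀ p : ℝ → Prop, ({t | t ∈ T ∧ p t}.ncard : ℤ) = ∑ t ∈ T, if p t then 1 else 0 :=
    fun p => by
      rw [← Finset.coe_filter, Set.ncard_coe_finset, Finset.card_filter]
      push_cast
      rfl
  have hdiff : ({t | t ∈ T ∧ (∀ᶠ u in 𝓝[<] t, u ∈ A) ∧ ∀ᶠ u in 𝓝[>] t, u ∈ B}.ncard : ℤ) -
      {t | t ∈ T ∧ (∀ᶠ u in 𝓝[<] t, u ∈ B) ∧ ∀ᶠ u in 𝓝[>] t, u ∈ A}.ncard = 0 := by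
    rw [hcard, hcard, ← Finset.sum_sub_distrib]
    refine (Finset.sum_congr rfl fun t _ => ?_).trans hsum
    by_cases h1 : ∀ᶠ u in 𝓝[<] t, u ∈ A <;> by_cases h2 : ∀ᶠ u in 𝓝[>] t, u ∈ A <;>
      simp only [hLdef, hRdef, hl, hr, h1, h2] <;> simp
  omega

theorem Circle1.exists_int_add {s t : ℝ} (h : (s : Circle1) = t) : ∃ n : ℤ, s = t + n := by
  have h' : ((s - t : ℝ) : Circle1) = 0 := by rw [AddCircle.coe_sub, h, sub_self]
  obtain ⟨n, hn⟩ := (AddCircle.coe_eq_zero_iff (1 : ℝ)).1 h'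
  exact ⟨n, by simp at hn; linarith⟩

theorem Circle1.coe_add_int (t : ℝ) (n : ℤ) : ((t + n : ℝ) : Circle1) = t := by
  have : ((n : ℝ) : Circle1) = 0 := (AddCircle.coe_eq_zero_iff (1 : ℝ)).2 ⟨n, by simp⟩
  rw [AddCircle.coe_add, this, add_zero]

theorem Circle1.eq_of_coe_eq {s t : ℝ} (h : (s : Circle1) = t) (hst : |s - t| < 1) : s = t := by
  obtain ⟨n, hn⟩ := exists_int_add h
  have hn0 : n = 0 := by
    rw [hn, add_sub_cancel_left] at hst
    exact Int.abs_lt_one_iff.1 (by exact_mod_cast hst)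
  simpa [hn0] using hn

theorem Circle1.exists_lift {f : Circle1 → Circle1} (hf : Continuous f) :
    ∃ F : ℝ → ℝ, Continuous F ∧ ∀ t : ℝ, f t = (F t : Circle1) := by
  obtain ⟨e, he⟩ := QuotientAddGroup.mk_surjective (f ((0 : ℝ) : Circle1))
  obtain ⟨F, ⟨-, hF⟩, -⟩ :=
    (AddCircle.isCoveringMap_coe (1 : ℝ)).existsUnique_continuousMap_lifts
      (⟨fun t : ℝ => f t, hf.comp (AddCircle.continuous_mk' 1)⟩ : C(ℝ, Circle1)) 0 e he
  exact ⟨F, F.continuous, fun t => (congrFun hF t).symm⟩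

/-- Two lifts of a map to the circle on a connected set differ by a constant. -/
theorem Circle1.exists_add_const_of_coe_eq {s : Set ℝ} (hs : IsPreconnected s) {g h : ℝ → ℝ}
    (hg : ContinuousOn g s) (hh : ContinuousOn h s)
    (heq : ∀ u ∈ s, (g u : Circle1) = (h u : Circle1)) : ∃ c, ∀ u ∈ s, g u = h u + c := by
  rcases s.eq_empty_or_nonempty with rfl | ⟨a, ha⟩
  · exact ⟨0, by simp⟩
  refine ⟨g a - h a, (AddCircle.isCoveringMap_coe (1 : ℝ)).eqOn_of_comp_eqOn hs hg
    (hh.add continuousOn_const) (fun u hu => ?_) ha (by ring)⟩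
  simp [heq u hu, heq a ha]

/-- A local representative of `f` near a preimage of `π t` agrees near `t`, up to translations in
the source and the target, with a given lift. -/
theorem exists_translate_eq_of_lift {f : Circle1 → Circle1} {F : ℝ → ℝ} (hFc : Continuous F)
    (hF : ∀ t : ℝ, f t = (F t : Circle1)) {a t ε : ℝ} (ha : (a : Circle1) = t) {g : ℝ → ℝ}
    (hgc : Continuous g) (hg : ∀ u ∈ Ioo (a - ε) (a + ε), f u = (g u : Circle1)) :
    ∃ n c : ℝ, ∀ u ∈ Ioo (t - ε) (t + ε), u + n ∈ Ioo (a - ε) (a + ε) ∧ F u = g (u + n) + c := by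
  obtain ⟨n, rfl⟩ := Circle1.exists_int_add ha
  have hmem : ∀ u ∈ Ioo (t - ε) (t + ε), u + n ∈ Ioo (t + n - ε) (t + n + ε) := fun u hu =>
    ⟨by linarith [hu.1], by linarith [hu.2]⟩
  obtain ⟨c, hc⟩ := Circle1.exists_add_const_of_coe_eq (isPreconnected_Ioo (a := t - ε)
    (b := t + ε)) hFc.continuousOn (h := fun u => g (u + n)) (by fun_prop) fun u hu => by
      rw [← hF, ← hg _ (hmem u hu), Circle1.coe_add_int]
  exact ⟨n, c, fun u hu => ⟨hmem u hu, hc u hu⟩⟩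

theorem increasingAt_coe_iff {f : Circle1 → Circle1} {F : ℝ → ℝ} (hFc : Continuous F)
    (hF : ∀ t : ℝ, f t = (F t : Circle1)) (t : ℝ) :
    IncreasingAt f t ↔
      IsRegularPt f t ∧ ∃ ε > 0, StrictMonoOn F (Ioo (t - ε) (t + ε)) := by
  refine ⟨fun ⟨hreg, a, ha, ε, hε, g, hgc, hmono, hg⟩ => ⟨hreg, ε, hε, ?_⟩,
    fun ⟨hreg, ε, hε, hmono⟩ => ⟨hreg, t, rfl, ε, hε, F, hFc, hmono, fun u _ => hF u⟩⟩
  obtain ⟨n, c, h⟩ := exists_translate_eq_of_lift hFc hF ha hgc hg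
  intro u hu v hv huv
  rw [(h u hu).2, (h v hv).2]
  linarith [hmono (h u hu).1 (h v hv).1 (by linarith)]

theorem decreasingAt_coe_iff {f : Circle1 → Circle1} {F : ℝ → ℝ} (hFc : Continuous F)
    (hF : ∀ t : ℝ, f t = (F t : Circle1)) (t : ℝ) :
    DecreasingAt f t ↔
      IsRegularPt f t ∧ ∃ ε > 0, StrictAntiOn F (Ioo (t - ε) (t + ε)) := by
  refine ⟨fun ⟨hreg, a, ha, ε, hε, g, hgc, hanti, hg⟩ => ⟨hreg, ε, hε, ?_⟩,
    fun ⟨hreg, ε, hε, hanti⟩ => ⟨hreg, t, rfl, ε, hε, F, hFc, hanti, fun u _ => hF u⟩⟩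
  obtain ⟨n, c, h⟩ := exists_translate_eq_of_lift hFc hF ha hgc hg
  intro u hu v hv huv
  rw [(h u hu).2, (h v hv).2]
  linarith [hanti (h u hu).1 (h v hv).1 (by linarith)]

theorem isOpen_regularPts (f : Circle1 → Circle1) : IsOpen (RegularPts f) :=
  isOpen_iff_forall_mem_open.2 fun _ ⟨N, hN, hconn, hx, hemb⟩ =>
    ⟨N, fun _ hy => ⟨N, hN, hconn, hy, hemb⟩, hN, hx⟩

/-- The centres of intervals on which a hereditary property holds form an open set. -/
theorem isOpen_setOf_exists_Ioo {p : Set ℝ → Prop} (hp : ∀ s t, s ⊆ t → p t → p s) :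
    IsOpen {t : ℝ | ∃ ε > 0, p (Ioo (t - ε) (t + ε))} := by
  refine Metric.isOpen_iff.2 fun t ⟨ε, hε, h⟩ => ⟨ε / 2, by positivity, fun u hu =>
    ⟨ε / 2, by positivity, hp _ _ (Ioo_subset_Ioo ?_ ?_) h⟩⟩ <;>
  · rw [Metric.mem_ball, Real.dist_eq, abs_lt] at hu
    linarith [hu.1, hu.2]

theorem isOpen_preimage_rPlus {f : Circle1 → Circle1} (hf : Continuous f) :
    IsOpen {t : ℝ | (t : Circle1) ∈ RPlus f} := by
  obtain ⟨F, hFc, hF⟩ := Circle1.exists_lift hf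
  simp only [RPlus, mem_ofPred_eq, increasingAt_coe_iff hFc hF]
  exact ((isOpen_regularPts f).preimage (AddCircle.continuous_mk' 1)).inter
    (isOpen_setOf_exists_Ioo fun _ _ hst h => h.mono hst)

theorem isOpen_preimage_rMinus {f : Circle1 → Circle1} (hf : Continuous f) :
    IsOpen {t : ℝ | (t : Circle1) ∈ RMinus f} := by
  obtain ⟨F, hFc, hF⟩ := Circle1.exists_lift hf
  simp only [RMinus, mem_ofPred_eq, decreasingAt_coe_iff hFc hF]
  exact ((isOpen_regularPts f).preimage (AddCircle.continuous_mk' 1)).inter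
    (isOpen_setOf_exists_Ioo fun _ _ hst h => h.mono hst)

theorem disjoint_rPlus_rMinus {f : Circle1 → Circle1} (hf : Continuous f) :
    Disjoint (RPlus f) (RMinus f) := by
  obtain ⟨F, hFc, hF⟩ := Circle1.exists_lift hf
  refine Set.disjoint_left.2 fun x hp hm => ?_
  obtain ⟨t, rfl⟩ := QuotientAddGroup.mk_surjective x
  obtain ⟨-, ε, hε, hmono⟩ := (increasingAt_coe_iff hFc hF t).1 hp
  obtain ⟨-, δ, hδ, hanti⟩ := (decreasingAt_coe_iff hFc hF t).1 hm
  have hη : 0 < min ε δ := lt_min hε hδ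
  have hε' := min_le_left ε δ
  have hδ' := min_le_right ε δ
  have hlt : t < t + min ε δ / 2 := by linarith
  exact (hmono ⟨by linarith, by linarith⟩ ⟨by linarith, by linarith⟩ hlt).not_gt
    (hanti ⟨by linarith, by linarith⟩ ⟨by linarith, by linarith⟩ hlt)

theorem regularPts_subset_rPlus_union_rMinus {f : Circle1 → Circle1} (hf : Continuous f) :
    RegularPts f ⊆ RPlus f ∪ RMinus f := by
  obtain ⟨F, hFc, hF⟩ := Circle1.exists_lift hf
  intro x hx
  obtain ⟨t, rfl⟩ := QuotientAddGroup.mk_surjective x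
  obtain ⟨N, hN, -, htN, hemb⟩ := id hx
  have hinj : InjOn f N := injOn_iff_injective.2 hemb.injective
  obtain ⟨ε, hε, hball⟩ := Metric.isOpen_iff.1
    (hN.preimage (AddCircle.continuous_mk' (1 : ℝ))) t htN
  set δ := min ε (1 / 2)
  have hδ : 0 < δ := lt_min hε (by norm_num)
  have hδε : δ ≤ ε := min_le_left _ _
  have hδ1 : δ ≤ 1 / 2 := min_le_right _ _
  have hmem : ∀ u ∈ Ioo (t - δ) (t + δ), (u : Circle1) ∈ N := fun u hu => hball <| by
    rw [Metric.mem_ball, Real.dist_eq, abs_lt]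
    constructor <;> linarith [hu.1, hu.2]
  have hFinj : InjOn F (Ioo (t - δ) (t + δ)) := fun u hu v hv huv =>
    Circle1.eq_of_coe_eq (hinj (hmem u hu) (hmem v hv) (by rw [hF, hF, huv])) <| by
      rw [abs_lt]
      constructor <;> linarith [hu.1, hu.2, hv.1, hv.2]
  rcases hFc.continuousOn.strictMonoOn_of_injOn_Ioo (by linarith) hFinj with h | h
  · exact Or.inl ((increasingAt_coe_iff hFc hF t).2 ⟨hx, δ, hδ, h⟩)
  · exact Or.inr ((decreasingAt_coe_iff hFc hF t).2 ⟨hx, δ, hδ, h⟩)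

theorem eventually_nhdsLT_coe_congr {s t : ℝ} (h : (s : Circle1) = t) (P : Set Circle1) :
    (∀ᶠ u : ℝ in 𝓝[<] s, (u : Circle1) ∈ P) ↔ ∀ᶠ u : ℝ in 𝓝[<] t, (u : Circle1) ∈ P := by
  obtain ⟨n, rfl⟩ := Circle1.exists_int_add h
  rw [← Filter.map_add_right_nhdsLT, Filter.eventually_map]
  simp only [Circle1.coe_add_int]

theorem eventually_nhdsGT_coe_congr {s t : ℝ} (h : (s : Circle1) = t) (P : Set Circle1) :
    (∀ᶠ u : ℝ in 𝓝[>] s, (u : Circle1) ∈ P) ↔ ∀ᶠ u : ℝ in 𝓝[>] t, (u : Circle1) ∈ P := by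
  obtain ⟨n, rfl⟩ := Circle1.exists_int_add h
  rw [← Filter.map_add_right_nhdsGT, Filter.eventually_map]
  simp only [Circle1.coe_add_int]

theorem exists_image_Ioo_subset_iff {P Q : Set Circle1} {t : ℝ} :
    (∃ a : ℝ, (a : Circle1) = t ∧ ∃ ε ∈ Ioo (0 : ℝ) (1 / 2),
      (fun t : ℝ => ((t : ℝ) : Circle1)) '' Ioo (a - ε) a ⊆ P ∧
      (fun t : ℝ => ((t : ℝ) : Circle1)) '' Ioo a (a + ε) ⊆ Q) ↔
    (∀ᶠ u : ℝ in 𝓝[<] t, (u : Circle1) ∈ P) ∧ ∀ᶠ u : ℝ in 𝓝[>] t, (u : Circle1) ∈ Q := by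
  constructor
  · rintro ⟨a, ha, ε, hε, hP, hQ⟩
    rw [← eventually_nhdsLT_coe_congr ha, ← eventually_nhdsGT_coe_congr ha]
    exact ⟨Filter.mem_of_superset (Ioo_mem_nhdsLT (by linarith [hε.1])) (image_subset_iff.1 hP),
      Filter.mem_of_superset (Ioo_mem_nhdsGT (by linarith [hε.1])) (image_subset_iff.1 hQ)⟩
  · rintro ⟨hP, hQ⟩
    obtain ⟨l, hl, hP⟩ := mem_nhdsLT_iff_exists_Ioo_subset.1 hP
    obtain ⟨r, hr, hQ⟩ := mem_nhdsGT_iff_exists_Ioo_subset.1 hQ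
    have hl : l < t := hl
    have hr : t < r := hr
    have h1 : min (1 / 4) (min (t - l) (r - t)) ≤ 1 / 4 := min_le_left _ _
    have h2 : min (1 / 4) (min (t - l) (r - t)) ≤ t - l :=
      (min_le_right _ _).trans (min_le_left _ _)
    have h3 : min (1 / 4) (min (t - l) (r - t)) ≤ r - t :=
      (min_le_right _ _).trans (min_le_right _ _)
    refine ⟨t, rfl, min (1 / 4) (min (t - l) (r - t)), ⟨?_, by linarith⟩,
      image_subset_iff.2 ((Ioo_subset_Ioo (by linarith) le_rfl).trans hP),
      image_subset_iff.2 ((Ioo_subset_Ioo le_rfl (by linarith)).trans hQ)⟩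
    exact lt_min (by norm_num) (lt_min (by linarith) (by linarith))

theorem hasLocalMaxAt_coe_iff {f : Circle1 → Circle1} {t : ℝ} :
    HasLocalMaxAt f t ↔ (∀ᶠ u : ℝ in 𝓝[<] t, (u : Circle1) ∈ RPlus f) ∧
      ∀ᶠ u : ℝ in 𝓝[>] t, (u : Circle1) ∈ RMinus f :=
  exists_image_Ioo_subset_iff

theorem hasLocalMinAt_coe_iff {f : Circle1 → Circle1} {t : ℝ} :
    HasLocalMinAt f t ↔ (∀ᶠ u : ℝ in 𝓝[<] t, (u : Circle1) ∈ RMinus f) ∧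
      ∀ᶠ u : ℝ in 𝓝[>] t, (u : Circle1) ∈ RPlus f :=
  exists_image_Ioo_subset_iff

/-- No regular point separates increasing points from decreasing ones. -/
theorem mem_singularPts_of_hasLocalMaxAt_or_hasLocalMinAt {f : Circle1 → Circle1}
    (hf : Continuous f) {x : Circle1} (hx : HasLocalMaxAt f x ∨ HasLocalMinAt f x) :
    x ∈ SingularPts f := by
  refine ⟨mem_univ x, fun hreg => ?_⟩
  obtain ⟨t, rfl⟩ := QuotientAddGroup.mk_surjective x
  have key : ∀ {l : Filter ℝ} [l.NeBot], (∀ᶠ u : ℝ in l, (u : Circle1) ∈ RPlus f) →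
      (∀ᶠ u : ℝ in l, (u : Circle1) ∈ RMinus f) → False := fun hp hm => by
    obtain ⟨u, hu⟩ := (hp.and hm).exists
    exact (disjoint_rPlus_rMinus hf).le_bot hu
  rcases regularPts_subset_rPlus_union_rMinus hf hreg with h | h
  · have h' := (isOpen_preimage_rPlus hf).mem_nhds h
    rcases hx with hx | hx
    · exact key (nhdsWithin_le_nhds h') (hasLocalMaxAt_coe_iff.1 hx).2
    · exact key (nhdsWithin_le_nhds h') (hasLocalMinAt_coe_iff.1 hx).1
  · have h' := (isOpen_preimage_rMinus hf).mem_nhds h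
    rcases hx with hx | hx
    · exact key (hasLocalMaxAt_coe_iff.1 hx).1 (nhdsWithin_le_nhds h')
    · exact key (hasLocalMinAt_coe_iff.1 hx).2 (nhdsWithin_le_nhds h')

theorem finite_singularPts {f : Circle1 → Circle1}
    (hiso : ∀ x ∈ SingularPts f, ∃ N : Set Circle1, IsOpen N ∧ N ∩ SingularPts f = {x}) :
    (SingularPts f).Finite := by
  have hclosed : IsClosed (SingularPts f) := by
    rw [SingularPts, ← compl_eq_univ_sdiff]
    exact (isOpen_regularPts f).isClosed_compl
  refine hclosed.isCompact.finite (isDiscrete_iff_forall_mem_exists_isOpen.2 fun x hx => ?_)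
  obtain ⟨N, hN, h⟩ := hiso x hx
  exact ⟨N, hN, h⟩

theorem eventually_nhdsNE_coe_notMem {S : Set Circle1} (hS : S.Finite) (t : ℝ) :
    ∀ᶠ u : ℝ in 𝓝[≠] t, (u : Circle1) ∉ S := by
  have hopen : ∀ᶠ x in 𝓝 (t : Circle1), x ∉ S \ {(t : Circle1)} :=
    (hS.subset sdiff_subset).isClosed.isOpen_compl.mem_nhds (by simp)
  have hpull := (AddCircle.continuous_mk' (1 : ℝ)).continuousAt.eventually hopen
  filter_upwards [nhdsWithin_le_nhds hpull, nhdsWithin_le_nhds (Metric.ball_mem_nhds t one_pos),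
    self_mem_nhdsWithin] with u hu hut hne huS
  exact hu ⟨huS, fun h => hne (Circle1.eq_of_coe_eq h hut)⟩

theorem Circle1.injOn_coe_Ico : InjOn (fun t : ℝ => (t : Circle1)) (Ico 0 1) :=
  fun u hu v hv h => Circle1.eq_of_coe_eq h <| by
    rw [abs_lt]
    constructor <;> linarith [hu.1, hu.2, hv.1, hv.2]

theorem Circle1.exists_mem_Ico (x : Circle1) : ∃ t ∈ Ico (0 : ℝ) 1, (t : Circle1) = x := by
  obtain ⟨t, rfl⟩ := QuotientAddGroup.mk_surjective x
  refine ⟨Int.fract t, ⟨Int.fract_nonneg t, Int.fract_lt_one t⟩, ?_⟩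
  rw [← Circle1.coe_add_int (Int.fract t) ⌊t⌋, Int.fract_add_floor]

/-- Points of the circle can be counted in the fundamental domain `[0, 1)`. -/
theorem Circle1.ncard_setOf_eq {p : Circle1 → Prop} {T : Set ℝ} (hT : T ⊆ Ico 0 1)
    (hp : ∀ t ∈ Ico (0 : ℝ) 1, p t → t ∈ T) :
    {x | p x}.ncard = {t : ℝ | t ∈ T ∧ p t}.ncard := by
  rw [← (Circle1.injOn_coe_Ico.mono fun t ht => hT ht.1).ncard_image]
  congr 1
  ext x
  constructor
  · intro hx
    obtain ⟨t, ht, rfl⟩ := Circle1.exists_mem_Ico x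
    exact ⟨t, ⟨hp t ht hx, hx⟩, rfl⟩
  · rintro ⟨t, ⟨-, h⟩, rfl⟩
    exact h

/-- If `f : S¹ → S¹` is continuous and every singular point of `f` is isolated in
`S(f)`, then `S(f)` is finite and the number of points at which `f` has a local
maximum equals the number of points at which `f` has a local minimum (both of these
sets being finite). -/
theorem card_localMax_eq_card_localMin (f : Circle1 → Circle1) (hf : Continuous f)
    (hiso : ∀ x ∈ SingularPts f, ∃ N : Set Circle1, IsOpen N ∧ N ∩ SingularPts f = {x}) :
    (SingularPts f).Finite ∧
    {x | HasLocalMaxAt f x}.Finite ∧ {x | HasLocalMinAt f x}.Finite ∧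
    {x | HasLocalMaxAt f x}.ncard = {x | HasLocalMinAt f x}.ncard := by
  have hS := finite_singularPts hiso
  have hsing := fun x => mem_singularPts_of_hasLocalMaxAt_or_hasLocalMinAt hf (x := x)
  refine ⟨hS, hS.subset fun x hx => hsing x (Or.inl hx), hS.subset fun x hx => hsing x (Or.inr hx),
    ?_⟩
  have hTfin : {t : ℝ | t ∈ Ico (0 : ℝ) 1 ∧ (t : Circle1) ∈ SingularPts f}.Finite :=
    Finite.of_finite_image (hS.subset (image_subset_iff.2 fun _ ht => ht.2))
      (Circle1.injOn_coe_Ico.mono fun _ ht => ht.1)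
  have hTmem : ∀ t, t ∈ hTfin.toFinset ↔ t ∈ Ico (0 : ℝ) 1 ∧ (t : Circle1) ∈ SingularPts f :=
    fun t => hTfin.mem_toFinset
  have hcover : ∀ t : ℝ, (t : Circle1) ∉ SingularPts f →
      t ∈ {t : ℝ | (t : Circle1) ∈ RPlus f} ∪ {t : ℝ | (t : Circle1) ∈ RMinus f} := fun t ht =>
    regularPts_subset_rPlus_union_rMinus hf (by_contra fun h => ht ⟨mem_univ _, h⟩)
  have hcount := card_transition_eq_card_transition (T := hTfin.toFinset)
    (isOpen_preimage_rPlus hf) (isOpen_preimage_rMinus hf)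
    ((disjoint_rPlus_rMinus hf).preimage _)
    (fun t => (eventually_nhdsNE_coe_notMem hS t).mono hcover)
    (fun t ht h => (hTmem t).2 ⟨ht, not_imp_comm.1 (hcover t) h⟩)
    (fun t ht => ((hTmem t).1 ht).1)
    (eventually_nhdsLT_coe_congr (by simpa using (Circle1.coe_add_int 0 1).symm) (RPlus f))
  have hT : (hTfin.toFinset : Set ℝ) ⊆ Ico 0 1 := fun t ht => ((hTmem t).1 ht).1
  rw [Circle1.ncard_setOf_eq hT fun t ht h => (hTmem t).2 ⟨ht, hsing _ (Or.inl h)⟩,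
    Circle1.ncard_setOf_eq hT fun t ht h => (hTmem t).2 ⟨ht, hsing _ (Or.inr h)⟩]
  simpa only [hasLocalMaxAt_coe_iff, hasLocalMinAt_coe_iff, Finset.mem_coe,
    mem_ofPred_eq] using hcount
end

section
/- Let f : S¹ → S¹ be a continuous map such that every point of S(f) is an isolated point of S(f). Then S(f) is a finite set of even cardinality, and at each point of S(f) the map f has either a local maximum or a local minimum. -/
open Set Topology

/-- The points near which `F : ℝ → ℝ` is strictly increasing. -/
def increasingLocus (F : ℝ → ℝ) : Set ℝ :=
  {t | ∃ ε > 0, StrictMonoOn F (Ioo (t - ε) (t + ε))}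

theorem isOpen_increasingLocus (F : ℝ → ℝ) : IsOpen (increasingLocus F) := by
  rw [Metric.isOpen_iff]
  rintro t ⟨ε, hε, h⟩
  refine ⟨ε / 2, by positivity, fun s hs => ⟨ε / 2, by positivity, h.mono ?_⟩⟩
  rw [Real.ball_eq_Ioo] at hs
  exact Ioo_subset_Ioo (by linarith [hs.1]) (by linarith [hs.2])

theorem disjoint_increasingLocus_neg (F : ℝ → ℝ) :
    Disjoint (increasingLocus F) (increasingLocus (-F)) := by
  rw [Set.disjoint_left]
  rintro t ⟨ε, hε, h⟩ ⟨δ, hδ, h'⟩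
  have hm : 0 < min ε δ := lt_min hε hδ
  have h1 := min_le_left ε δ
  have h2 := min_le_right ε δ
  have key := h (a := t) (b := t + min ε δ / 2) ⟨by linarith, by linarith⟩
    ⟨by linarith, by linarith⟩ (by linarith)
  have key' := h' (a := t) (b := t + min ε δ / 2) ⟨by linarith, by linarith⟩
    ⟨by linarith, by linarith⟩ (by linarith)
  simp only [Pi.neg_apply] at key'
  linarith

theorem exists_lt_of_mem_increasingLocus {F : ℝ → ℝ} {x c : ℝ} (hc : c ∈ increasingLocus F)
    (hxc : x < c) : ∃ z ∈ Ioo x c, F z < F c := by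
  obtain ⟨ε, hε, h⟩ := hc
  obtain ⟨z, hz, hzc⟩ := exists_between (max_lt hxc (sub_lt_self c hε))
  rw [max_lt_iff] at hz
  exact ⟨z, ⟨hz.1, hzc⟩, h ⟨hz.2, by linarith⟩ ⟨by linarith, by linarith⟩ hzc⟩

theorem strictMonoOn_of_subset_increasingLocus {F : ℝ → ℝ} (hF : Continuous F) {s : Set ℝ}
    (hs : s.OrdConnected) (h : s ⊆ increasingLocus F) : StrictMonoOn F s := by
  intro x hx y hy hxy
  obtain ⟨c, hc, hmin⟩ := isCompact_Icc.exists_isMinOn (nonempty_Icc.2 hxy.le) hF.continuousOn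
  have min_eq {c : ℝ} (hc : c ∈ Icc x y) (hmin : IsMinOn F (Icc x y) c) : c = x := by
    by_contra hne
    obtain ⟨z, hz, hzc⟩ := exists_lt_of_mem_increasingLocus (h (hs.out hx hy hc))
      (lt_of_le_of_ne hc.1 (Ne.symm hne))
    exact absurd (hmin ⟨hz.1.le, hz.2.le.trans hc.2⟩) (not_le.2 hzc)
  obtain rfl := min_eq hc hmin
  refine lt_of_le_of_ne (hmin ⟨hxy.le, le_rfl⟩) fun heq => hxy.ne' ?_
  exact min_eq ⟨hxy.le, le_rfl⟩ fun z hz => heq ▸ hmin hz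

/-- A continuous function increasing near every point of an interval other than `a` is strictly
increasing on that interval. -/
theorem strictMonoOn_Ioo_of_increasingLocus {F : ℝ → ℝ} (hF : Continuous F) {u a v : ℝ}
    (hua : u < a) (hav : a < v) (hl : Ioo u a ⊆ increasingLocus F)
    (hr : Ioo a v ⊆ increasingLocus F) : StrictMonoOn F (Ioo u v) := by
  have hl' := strictMonoOn_of_subset_increasingLocus hF ordConnected_Ioo hl
  have hr' := strictMonoOn_of_subset_increasingLocus hF ordConnected_Ioo hr
  have hleft {x : ℝ} (hx : x ∈ Ioo u a) : F x < F a := by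
    obtain ⟨z, hz⟩ := exists_between hx.2
    have hzm : z ∈ Ioo u a := ⟨hx.1.trans hz.1, hz.2⟩
    refine (hl' hx hzm hz.1).trans_le ?_
    refine ge_of_tendsto (hF.continuousWithinAt (s := Iio a) (x := a)) ?_
    filter_upwards [Ioo_mem_nhdsLT hz.2] with w hw
    exact (hl' hzm ⟨hzm.1.trans hw.1, hw.2⟩ hw.1).le
  have hright {x : ℝ} (hx : x ∈ Ioo a v) : F a < F x := by
    obtain ⟨z, hz⟩ := exists_between hx.1
    have hzm : z ∈ Ioo a v := ⟨hz.1, hz.2.trans hx.2⟩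
    refine lt_of_le_of_lt ?_ (hr' hzm hx hz.2)
    refine le_of_tendsto (hF.continuousWithinAt (s := Ioi a) (x := a)) ?_
    filter_upwards [Ioo_mem_nhdsGT hz.1] with w hw
    exact (hr' ⟨hw.1, hw.2.trans hzm.2⟩ hzm hw.2).le
  intro x hx y hy hxy
  rcases lt_trichotomy x a with hxa | rfl | hxa
  · rcases lt_trichotomy y a with hya | rfl | hya
    · exact hl' ⟨hx.1, hxa⟩ ⟨hy.1, hya⟩ hxy
    · exact hleft ⟨hx.1, hxa⟩
    · exact (hleft ⟨hx.1, hxa⟩).trans (hright ⟨hya, hy.2⟩)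
  · exact hright ⟨hxy, hy.2⟩
  · exact hr' ⟨hxa, hx.2⟩ ⟨hxa.trans hxy, hy.2⟩ hxy

/-- If `P` and `M` are disjoint open sets that exchange sides at each point of the complement of
their union, then two points lie in the same set exactly when they are separated by an even number
of points of that complement. -/
theorem even_ncard_inter_Ioo_iff {P M : Set ℝ} (hP : IsOpen P) (hM : IsOpen M)
    (hPM : Disjoint P M)
    (hswap : ∀ a ∉ P ∪ M, ∃ ε > 0, Ioo (a - ε) a ⊆ P ∧ Ioo a (a + ε) ⊆ M ∨
      Ioo (a - ε) a ⊆ M ∧ Ioo a (a + ε) ⊆ P)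
    {b c : ℝ} (hbc : b < c) (hb : b ∈ P ∪ M) (hc : c ∈ P ∪ M)
    (hfin : ((P ∪ M)ᶜ ∩ Ioo b c).Finite) :
    Even ((P ∪ M)ᶜ ∩ Ioo b c).ncard ↔ (b ∈ P ↔ c ∈ P) := by
  have conn {s : Set ℝ} (hs : IsPreconnected s) (h : s ⊆ P ∪ M) {x y : ℝ} (hx : x ∈ s)
      (hy : y ∈ s) : x ∈ P ↔ y ∈ P := by
    rcases hs.subset_or_subset hP hM hPM h with h | h
    · simp [h hx, h hy]
    · simp [Set.disjoint_right.1 hPM (h hx), Set.disjoint_right.1 hPM (h hy)]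
  obtain ⟨T, hT⟩ := hfin.exists_finset_coe
  rw [← hT, Set.ncard_coe_finset]
  clear hfin
  induction T using Finset.induction_on_max generalizing c with
  | empty =>
    simp only [Finset.card_empty, Even.zero, true_iff]
    refine conn (isPreconnected_Icc (a := b) (b := c)) (fun x hx => ?_) ⟨le_rfl, hbc.le⟩
      ⟨hbc.le, le_rfl⟩
    by_contra hxn
    have hxb : b ≠ x := fun h => hxn (h ▸ hb)
    have hxc : x ≠ c := fun h => hxn (h ▸ hc)
    have : x ∈ ((∅ : Finset ℝ) : Set ℝ) :=
      hT ▸ ⟨hxn, lt_of_le_of_ne hx.1 hxb, lt_of_le_of_ne hx.2 hxc⟩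
    simp at this
  | insert a T hmax ih =>
    have memT (x : ℝ) : x = a ∨ x ∈ T ↔ x ∉ P ∪ M ∧ x ∈ Ioo b c := by
      have h := Set.ext_iff.1 hT x
      simpa [mem_union] using h
    have haT : a ∉ T := fun h => lt_irrefl _ (hmax a h)
    obtain ⟨ha, hab, hac⟩ := (memT a).1 (Or.inl rfl)
    obtain ⟨ε, hε, hεa⟩ := hswap a ha
    obtain ⟨c', hc'l, hc'a⟩ : ∃ c', (∀ x ∈ insert (a - ε) (insert b T), x < c') ∧ c' < a := by
      have hne : (insert (a - ε) (insert b T)).Nonempty := Finset.insert_nonempty _ _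
      obtain ⟨c', h1, h2⟩ := exists_between (a₁ := (insert (a - ε) (insert b T)).max' hne) (a₂ := a)
        (by rw [Finset.max'_lt_iff]; simpa using ⟨hε, hab, hmax⟩)
      exact ⟨c', by rwa [Finset.max'_lt_iff] at h1, h2⟩
    simp only [Finset.mem_insert, forall_eq_or_imp] at hc'l
    obtain ⟨hc'ε, hbc', hTc'⟩ := hc'l
    obtain ⟨d, hd, hdm⟩ := exists_between (lt_min hac (show a < a + ε by linarith))
    rw [lt_min_iff] at hdm
    have hdc : d ∈ P ↔ c ∈ P := by
      refine conn (isPreconnected_Icc (a := d) (b := c)) (fun x hx => ?_) ⟨le_rfl, hdm.1.le⟩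
        ⟨hdm.1.le, le_rfl⟩
      by_contra hxn
      have hxc : x ≠ c := fun h => hxn (h ▸ hc)
      have hax : a < x := hd.trans_le hx.1
      rcases (memT x).2 ⟨hxn, hab.trans hax, lt_of_le_of_ne hx.2 hxc⟩ with rfl | h
      · exact lt_irrefl _ hax
      · exact lt_asymm hax (hmax x h)
    have hc'm : c' ∈ Ioo (a - ε) a := ⟨hc'ε, hc'a⟩
    have hdm' : d ∈ Ioo a (a + ε) := ⟨hd, hdm.2⟩
    have hflip : c' ∈ P ↔ d ∉ P := by
      rcases hεa with ⟨h1, h2⟩ | ⟨h1, h2⟩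
      · simp [h1 hc'm, Set.disjoint_right.1 hPM (h2 hdm')]
      · simp [Set.disjoint_right.1 hPM (h1 hc'm), h2 hdm']
    have hc'PM : c' ∈ P ∪ M := by
      rcases hεa with ⟨h1, h2⟩ | ⟨h1, h2⟩
      · exact Or.inl (h1 hc'm)
      · exact Or.inr (h1 hc'm)
    have hih : Even T.card ↔ (b ∈ P ↔ c' ∈ P) := ih hbc' hc'PM (by
      ext x
      constructor
      · intro hx
        obtain ⟨h1, h2⟩ := (memT x).1 (Or.inr hx)
        exact ⟨h1, h2.1, hTc' x hx⟩
      · rintro ⟨h1, h2⟩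
        refine ((memT x).2 ⟨h1, h2.1, h2.2.trans (hc'a.trans hac)⟩).resolve_left ?_
        exact (h2.2.trans hc'a).ne)
    rw [Finset.card_insert_of_notMem haT, Nat.even_add_one, hih, hflip, hdc]
    tauto

theorem abs_sub_lt_one_of_mem_Ioo {t δ x y : ℝ} (hδ : δ ≤ 1 / 2) (hx : x ∈ Ioo (t - δ) (t + δ))
    (hy : y ∈ Ioo (t - δ) (t + δ)) : |x - y| < 1 := by
  rw [abs_lt]
  constructor <;> linarith [hx.1, hx.2, hy.1, hy.2]

theorem Circle1.eq_of_coe_eq_s7 {x y : ℝ} (h : (x : Circle1) = y) (hxy : |x - y| < 1) : x = y := by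
  obtain ⟨n, hn⟩ := (QuotientAddGroup.eq_iff_sub_mem.1 h : x - y ∈ AddSubgroup.zmultiples (1 : ℝ))
  simp only [zsmul_eq_mul, mul_one] at hn
  rw [← hn] at hxy
  have : n = 0 := Int.abs_lt_one_iff.1 (by exact_mod_cast hxy)
  rw [this] at hn
  push_cast at hn
  linarith

theorem injOn_lift_of_isRegularPt {f : Circle1 → Circle1} {F : ℝ → ℝ}
    (hfF : ∀ t : ℝ, f t = (F t : Circle1)) {t : ℝ} (h : IsRegularPt f t) :
    ∃ ε > 0, InjOn F (Ioo (t - ε) (t + ε)) := by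
  obtain ⟨N, hN, -, htN, hemb⟩ := h
  have hpre : ((↑) : ℝ → Circle1) ⁻¹' N ∈ 𝓝 t :=
    (hN.preimage (AddCircle.continuous_mk' 1)).mem_nhds htN
  obtain ⟨ε, hε, hball⟩ := Metric.mem_nhds_iff.1 hpre
  rw [Real.ball_eq_Ioo] at hball
  have hle : Ioo (t - min ε (1 / 2)) (t + min ε (1 / 2)) ⊆ Ioo (t - ε) (t + ε) :=
    Ioo_subset_Ioo (by linarith [min_le_left ε (1 / 2)]) (by linarith [min_le_left ε (1 / 2)])
  refine ⟨min ε (1 / 2), by positivity, fun x hx y hy hxy => ?_⟩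
  have hinj : Subtype.mk (x : Circle1) (hball (hle hx)) = ⟨y, hball (hle hy)⟩ := by
    refine hemb.injective ?_
    change f x = f y
    rw [hfF, hfF, hxy]
  exact Circle1.eq_of_coe_eq_s7 (congrArg Subtype.val hinj)
    (abs_sub_lt_one_of_mem_Ioo (min_le_right _ _) hx hy)

theorem isRegularPt_of_injOn_lift {f : Circle1 → Circle1} (hf : Continuous f) {F : ℝ → ℝ}
    (hF : Continuous F) (hfF : ∀ t : ℝ, f t = (F t : Circle1)) {t ε : ℝ} (hε : 0 < ε)
    (h : InjOn F (Ioo (t - ε) (t + ε))) : IsRegularPt f t := by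
  have hnhds : F ⁻¹' Ioo (F t - 1 / 2) (F t + 1 / 2) ∩ Ioo (t - ε) (t + ε) ∈ 𝓝 t :=
    Filter.inter_mem (hF.continuousAt (Ioo_mem_nhds (by linarith) (by linarith)))
      (Ioo_mem_nhds (by linarith) (by linarith))
  obtain ⟨δ, hδ, hball⟩ := Metric.nhds_basis_closedBall.mem_iff.1 hnhds
  rw [Real.closedBall_eq_Icc] at hball
  set K : Set Circle1 := ((↑) : ℝ → Circle1) '' Icc (t - δ) (t + δ)
  have hK : IsCompact K := isCompact_Icc.image (AddCircle.continuous_mk' 1)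
  have hinj : InjOn f K := by
    rintro _ ⟨x, hx, rfl⟩ _ ⟨y, hy, rfl⟩ hxy
    rw [hfF, hfF] at hxy
    rw [h (hball hx).2 (hball hy).2 (Circle1.eq_of_coe_eq_s7 hxy
      (abs_sub_lt_one_of_mem_Ioo le_rfl (hball hx).1 (hball hy).1))]
  have : CompactSpace K := isCompact_iff_compactSpace.1 hK
  have hemb : IsEmbedding (K.domRestrict f) :=
    ((hf.comp continuous_subtype_val).isClosedEmbedding
      (injOn_iff_injective.1 hinj)).isEmbedding
  have hsub : ((↑) : ℝ → Circle1) '' Ioo (t - δ) (t + δ) ⊆ K := image_mono Ioo_subset_Icc_self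
  refine ⟨((↑) : ℝ → Circle1) '' Ioo (t - δ) (t + δ),
    QuotientAddGroup.isOpenMap_coe _ isOpen_Ioo,
    (isConnected_Ioo (by linarith)).image _ (AddCircle.continuous_mk' 1).continuousOn,
    ⟨t, ⟨by linarith, by linarith⟩, rfl⟩, ?_⟩
  exact hemb.comp (IsEmbedding.inclusion hsub)

theorem isRegularPt_iff_mem_increasingLocus {f : Circle1 → Circle1} (hf : Continuous f) {F : ℝ → ℝ}
    (hF : Continuous F) (hfF : ∀ t : ℝ, f t = (F t : Circle1)) (t : ℝ) :
    IsRegularPt f t ↔ t ∈ increasingLocus F ∪ increasingLocus (-F) := by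
  constructor
  · intro h
    obtain ⟨ε, hε, hinj⟩ := injOn_lift_of_isRegularPt hfF h
    rcases hF.continuousOn.strictMonoOn_of_injOn_Ioo (by linarith) hinj with h | h
    · exact Or.inl ⟨ε, hε, h⟩
    · exact Or.inr ⟨ε, hε, h.neg⟩
  · rintro (⟨ε, hε, h⟩ | ⟨ε, hε, h⟩)
    · exact isRegularPt_of_injOn_lift hf hF hfF hε h.injOn
    · exact isRegularPt_of_injOn_lift hf hF hfF hε fun x hx y hy hxy =>
        h.injOn hx hy (congrArg Neg.neg hxy)

theorem mem_RPlus_of_mem_increasingLocus {f : Circle1 → Circle1} (hf : Continuous f) {F : ℝ → ℝ}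
    (hF : Continuous F) (hfF : ∀ t : ℝ, f t = (F t : Circle1)) {t : ℝ}
    (ht : t ∈ increasingLocus F) : (t : Circle1) ∈ RPlus f := by
  have hreg := (isRegularPt_iff_mem_increasingLocus hf hF hfF t).2 (Or.inl ht)
  obtain ⟨ε, hε, h⟩ := ht
  exact ⟨hreg, t, rfl, ε, hε, F, hF, h, fun s _ => hfF s⟩

theorem mem_RMinus_of_mem_increasingLocus_neg {f : Circle1 → Circle1} (hf : Continuous f)
    {F : ℝ → ℝ} (hF : Continuous F) (hfF : ∀ t : ℝ, f t = (F t : Circle1)) {t : ℝ}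
    (ht : t ∈ increasingLocus (-F)) : (t : Circle1) ∈ RMinus f := by
  have hreg := (isRegularPt_iff_mem_increasingLocus hf hF hfF t).2 (Or.inr ht)
  obtain ⟨ε, hε, h⟩ := ht
  exact ⟨hreg, t, rfl, ε, hε, F, hF, by simpa using h.neg, fun s _ => hfF s⟩

theorem add_one_mem_increasingLocus {f : Circle1 → Circle1} {F : ℝ → ℝ} (hF : Continuous F)
    (hfF : ∀ t : ℝ, f t = (F t : Circle1)) {t : ℝ} (ht : t ∈ increasingLocus F) :
    t + 1 ∈ increasingLocus F := by
  have coe_add_one (s : ℝ) : ((s + 1 : ℝ) : Circle1) = s := AddCircle.coe_add_period 1 s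
  have hcoe (s : ℝ) : (F (s + 1) : Circle1) = F s := by rw [← hfF, ← hfF, coe_add_one]
  have hshift : (fun s => F (s + 1)) = fun s => F s + (F 1 - F 0) := by
    refine (AddCircle.isCoveringMap_coe (1 : ℝ)).eq_of_comp_eq (by fun_prop) (by fun_prop) ?_ 0
      (by simp)
    funext s
    have h0 := hcoe 0
    rw [zero_add] at h0
    simp [hcoe, h0]
  obtain ⟨ε, hε, h⟩ := ht
  refine ⟨ε, hε, fun x hx y hy hxy => ?_⟩
  have key := h (a := x - 1) (b := y - 1) ⟨by linarith [hx.1], by linarith [hx.2]⟩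
    ⟨by linarith [hy.1], by linarith [hy.2]⟩ (by linarith)
  have hx' := congrFun hshift (x - 1)
  have hy' := congrFun hshift (y - 1)
  simp only [sub_add_cancel] at hx' hy'
  linarith

/-- At an isolated point outside the loci where `F` increases or decreases, `F` switches between
increasing and decreasing. -/
theorem increasingLocus_swap {F : ℝ → ℝ} (hF : Continuous F) {a ε : ℝ} (hε : 0 < ε)
    (ha : a ∉ increasingLocus F ∪ increasingLocus (-F))
    (hl : Ioo (a - ε) a ⊆ increasingLocus F ∪ increasingLocus (-F))
    (hr : Ioo a (a + ε) ⊆ increasingLocus F ∪ increasingLocus (-F)) :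
    Ioo (a - ε) a ⊆ increasingLocus F ∧ Ioo a (a + ε) ⊆ increasingLocus (-F) ∨
      Ioo (a - ε) a ⊆ increasingLocus (-F) ∧ Ioo a (a + ε) ⊆ increasingLocus F := by
  have split {s : Set ℝ} (hs : IsPreconnected s)
      (h : s ⊆ increasingLocus F ∪ increasingLocus (-F)) :=
    hs.subset_or_subset (isOpen_increasingLocus F) (isOpen_increasingLocus (-F))
      (disjoint_increasingLocus_neg F) h
  rw [mem_union, not_or] at ha
  rcases split isPreconnected_Ioo hl with hl | hl <;> rcases split isPreconnected_Ioo hr with hr | hr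
  · exact absurd ⟨ε, hε, strictMonoOn_Ioo_of_increasingLocus hF (by linarith) (by linarith) hl hr⟩
      ha.1
  · exact Or.inl ⟨hl, hr⟩
  · exact Or.inr ⟨hl, hr⟩
  · exact absurd ⟨ε, hε, strictMonoOn_Ioo_of_increasingLocus hF.neg (by linarith) (by linarith)
      hl hr⟩ ha.2

theorem coe_image_inter_Ioo_eq {s : Set Circle1} {b : ℝ} (hb : (b : Circle1) ∉ s) :
    ((↑) : ℝ → Circle1) '' (((↑) : ℝ → Circle1) ⁻¹' s ∩ Ioo b (b + 1)) = s := by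
  ext x
  constructor
  · rintro ⟨t, ⟨ht, -⟩, rfl⟩
    exact ht
  · intro hx
    obtain ⟨t, ht, rfl⟩ : x ∈ ((↑) : ℝ → Circle1) '' Ico b (b + 1) := by
      rw [AddCircle.coe_image_Ico_eq]; trivial
    refine ⟨t, ⟨hx, lt_of_le_of_ne ht.1 ?_, ht.2⟩, rfl⟩
    rintro rfl
    exact hb hx

theorem injOn_coe_Ioo (b : ℝ) : InjOn ((↑) : ℝ → Circle1) (Ioo b (b + 1)) := fun _ hx _ hy h =>
  (AddCircle.coe_eq_coe_iff_of_mem_Ico (Ioo_subset_Ico_self hx) (Ioo_subset_Ico_self hy)).1 h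

/-- If `f : S¹ → S¹` is continuous and every singular point of `f` is isolated in
`S(f)`, then `S(f)` is a finite set of even cardinality, and at each singular point
`f` has either a local maximum or a local minimum. -/
theorem singularPts_finite_even_and_max_or_min (f : Circle1 → Circle1) (hf : Continuous f)
    (hiso : ∀ x ∈ SingularPts f, ∃ N : Set Circle1, IsOpen N ∧ N ∩ SingularPts f = {x}) :
    (SingularPts f).Finite ∧ Even (SingularPts f).ncard ∧
    ∀ x ∈ SingularPts f, HasLocalMaxAt f x ∨ HasLocalMinAt f x := by
  obtain ⟨F, hF, hfF⟩ := Circle1.exists_lift hf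
  have hfin := finite_singularPts hiso
  set P := increasingLocus F
  set M := increasingLocus (-F)
  have hreg (t : ℝ) : IsRegularPt f t ↔ t ∈ P ∪ M :=
    isRegularPt_iff_mem_increasingLocus hf hF hfF t
  have hsing (t : ℝ) : (t : Circle1) ∈ SingularPts f ↔ t ∉ P ∪ M := by
    rw [← hreg]; simp [SingularPts, RegularPts]
  have hswap (a : ℝ) (ha : a ∉ P ∪ M) : ∃ ε ∈ Ioo (0 : ℝ) (1 / 2),
      Ioo (a - ε) a ⊆ P ∧ Ioo a (a + ε) ⊆ M ∨ Ioo (a - ε) a ⊆ M ∧ Ioo a (a + ε) ⊆ P := by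
    obtain ⟨N, hN, hNa⟩ := hiso a ((hsing a).2 ha)
    have haN : (a : Circle1) ∈ N := (hNa.symm.subset rfl).1
    obtain ⟨δ, hδ, hball⟩ := Metric.mem_nhds_iff.1
      ((hN.preimage (AddCircle.continuous_mk' (1 : ℝ))).mem_nhds haN)
    rw [Real.ball_eq_Ioo] at hball
    obtain ⟨ε, hε, hεm⟩ := exists_between (show (0 : ℝ) < min δ (1 / 2) by positivity)
    rw [lt_min_iff] at hεm
    have hmem {x : ℝ} (hx : x ∈ Ioo (a - ε) (a + ε)) (hxa : x ≠ a) : x ∈ P ∪ M := by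
      by_contra hxn
      have hxN : (x : Circle1) ∈ N := hball ⟨by linarith [hx.1], by linarith [hx.2]⟩
      exact hxa (Circle1.eq_of_coe_eq_s7 (hNa.subset ⟨hxN, (hsing x).2 hxn⟩)
        (abs_sub_lt_one_of_mem_Ioo hεm.2.le hx ⟨by linarith, by linarith⟩))
    exact ⟨ε, ⟨hε, hεm.2⟩, increasingLocus_swap hF hε ha
      (fun x hx => hmem ⟨hx.1, by linarith [hx.2]⟩ hx.2.ne)
      (fun x hx => hmem ⟨by linarith [hx.1], hx.2⟩ hx.1.ne')⟩
  refine ⟨hfin, ?_, fun x hx => ?_⟩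
  · rcases (SingularPts f).eq_empty_or_nonempty with hempty | ⟨x, hx⟩
    · simp [hempty]
    obtain ⟨a, rfl⟩ := QuotientAddGroup.mk_surjective x
    obtain ⟨b, hb⟩ : ∃ b, b ∈ P ∪ M := by
      obtain ⟨ε, hε, h⟩ := hswap a ((hsing a).1 hx)
      have hmem : a - ε / 2 ∈ Ioo (a - ε) a := ⟨by linarith [hε.1], by linarith [hε.1]⟩
      exact ⟨a - ε / 2, h.elim (fun h => Or.inl (h.1 hmem)) fun h => Or.inr (h.1 hmem)⟩
    have hfF' (t : ℝ) : -f t = ((-F) t : Circle1) := by simp [hfF]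
    have hPadd {t : ℝ} (ht : t ∈ P) : t + 1 ∈ P := add_one_mem_increasingLocus hF hfF ht
    have hMadd {t : ℝ} (ht : t ∈ M) : t + 1 ∈ M :=
      add_one_mem_increasingLocus (f := fun x => -f x) hF.neg hfF' ht
    have hb1 : b + 1 ∈ P ∪ M := hb.imp hPadd hMadd
    have hPM : Disjoint P M := disjoint_increasingLocus_neg F
    have hiff : b ∈ P ↔ b + 1 ∈ P := by
      refine ⟨hPadd, fun h => hb.resolve_right fun hbM => ?_⟩
      exact Set.disjoint_left.1 hPM h (hMadd hbM)
    have hpre : ((↑) : ℝ → Circle1) ⁻¹' SingularPts f = (P ∪ M)ᶜ := ext hsing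
    have himg := coe_image_inter_Ioo_eq (s := SingularPts f) (b := b)
      (fun h => (hsing b).1 h hb)
    have hinj : InjOn ((↑) : ℝ → Circle1) (((↑) : ℝ → Circle1) ⁻¹' SingularPts f ∩ Ioo b (b + 1)) :=
      (injOn_coe_Ioo b).mono inter_subset_right
    rw [← himg, hinj.ncard_image, hpre]
    refine (even_ncard_inter_Ioo_iff (isOpen_increasingLocus F) (isOpen_increasingLocus (-F)) hPM
      (fun a ha => ?_) (lt_add_one b) hb hb1 ?_).2 hiff
    · obtain ⟨ε, hε, h⟩ := hswap a ha
      exact ⟨ε, hε.1, h⟩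
    · rw [← hpre]
      exact Finite.of_finite_image (by rwa [himg]) hinj
  · obtain ⟨a, rfl⟩ := QuotientAddGroup.mk_surjective x
    obtain ⟨ε, hε, h⟩ := hswap a ((hsing a).1 hx)
    have plus {s : Set ℝ} (hs : s ⊆ P) : (fun t : ℝ => (t : Circle1)) '' s ⊆ RPlus f :=
      image_subset_iff.2 fun t ht => mem_RPlus_of_mem_increasingLocus hf hF hfF (hs ht)
    have minus {s : Set ℝ} (hs : s ⊆ M) : (fun t : ℝ => (t : Circle1)) '' s ⊆ RMinus f :=
      image_subset_iff.2 fun t ht => mem_RMinus_of_mem_increasingLocus_neg hf hF hfF (hs ht)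
    rcases h with ⟨h1, h2⟩ | ⟨h1, h2⟩
    · exact Or.inl ⟨a, rfl, ε, hε, plus h1, minus h2⟩
    · exact Or.inr ⟨a, rfl, ε, hε, minus h1, plus h2⟩
end

section
/- Let n be a natural number, let Q be a topological n-manifold with boundary, and let M ⊆ Q be a subset which, with the subspace topology, is itself a topological n-manifold with boundary, such that in(M) ⊆ in(Q), where in(M) denotes the image in Q of the manifold interior of M and in(Q) the manifold interior of Q. Then the map sending a connected component C of the subspace M ∩ in(Q) to its closure computed in the subspace M, and the map sending a connected component D of M to D ∩ in(Q), are well defined and are mutually inverse bijections between the set of connected components of M ∩ in(Q) and the set of connected components of M. -/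
open Set Topology
open scoped Manifold

theorem bijective_id_add_of_lipschitzWith {E : Type*} [NormedAddCommGroup E] [CompleteSpace E]
    {g : E → E} {K : NNReal} (hg : LipschitzWith K g) (hK : K < 1) :
    Function.Bijective fun x => x + g x := by
  have hcontr (y : E) : ContractingWith K fun x => y - g x :=
    ⟨hK, LipschitzWith.of_dist_le_mul fun a b => by
      rw [dist_sub_left]; exact hg.dist_le_mul a b⟩
  refine ⟨fun a b hab => ?_, fun y => ?_⟩
  · have ha : Function.IsFixedPt (fun x => (a + g a) - g x) a := by simp [Function.IsFixedPt]
    have hb : Function.IsFixedPt (fun x => (a + g a) - g x) b := by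
      simp only at hab
      simp [Function.IsFixedPt, hab]
    exact (hcontr _).fixedPoint_unique' ha hb
  · have h : y - g _ = _ := (hcontr y).fixedPoint_isFixedPt
    exact ⟨_, eq_sub_iff_add_eq.mp h.symm⟩

theorem lipschitzWith_indicator_closedBall {E F : Type*} [NormedAddCommGroup E] [NormedSpace ℝ E]
    [NormedAddCommGroup F] {g : E → F} {K : NNReal}
    (hg : LipschitzOnWith K g (Metric.closedBall 0 1)) (h0 : ∀ x, ‖x‖ = 1 → g x = 0) :
    LipschitzWith K ((Metric.closedBall 0 1).indicator g) := by
  have key (x y : E) (hx : x ∈ Metric.closedBall (0 : E) 1) (hy : y ∉ Metric.closedBall (0 : E) 1) :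
      dist (g x) 0 ≤ K * dist x y := by
    have hx' : ‖x‖ ≤ 1 := by simpa using hx
    have hy' : 1 ≤ ‖y‖ := by simpa using (not_le.mp (by simpa using hy)).le
    have hc : ContinuousOn (fun t : ℝ => ‖AffineMap.lineMap x y t‖) (Icc 0 1) := by
      apply Continuous.continuousOn
      exact (AffineMap.lineMap_continuous (R := ℝ)).norm
    obtain ⟨t, ht, htz⟩ := intermediate_value_Icc zero_le_one hc
      (show (1 : ℝ) ∈ Icc _ _ by simpa using ⟨hx', hy'⟩)
    simp only at htz
    rw [← h0 _ htz]
    refine (hg.dist_le_mul x hx _ (by simp [htz])).trans ?_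
    rw [dist_left_lineMap, Real.norm_of_nonneg ht.1]
    gcongr
    exact mul_le_of_le_one_left dist_nonneg ht.2
  refine LipschitzWith.of_dist_le_mul fun x y => ?_
  by_cases hx : x ∈ Metric.closedBall (0 : E) 1 <;> by_cases hy : y ∈ Metric.closedBall (0 : E) 1
  · simpa only [indicator_of_mem hx, indicator_of_mem hy] using hg.dist_le_mul x hx y hy
  · simpa only [indicator_of_mem hx, indicator_of_notMem hy] using key x y hx hy
  · simpa only [indicator_of_notMem hx, indicator_of_mem hy, dist_comm] using key y x hy hx
  · simp only [indicator_of_notMem hx, indicator_of_notMem hy, dist_self]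
    positivity

theorem exists_polynomial_eval_eq_det_id_add_smul {E : Type*} [NormedAddCommGroup E]
    [NormedSpace ℝ E] [FiniteDimensional ℝ E] (A : E →L[ℝ] E) :
    ∃ p : Polynomial ℝ, p.natDegree ≤ Module.finrank ℝ E ∧
      ∀ t : ℝ, p.eval t = (ContinuousLinearMap.id ℝ E + t • A).det := by
  let b := Module.finBasis ℝ E
  let B := LinearMap.toMatrix b b (A : E →ₗ[ℝ] E)
  refine ⟨_, (Polynomial.natDegree_det_X_add_C_le B 1).trans (by simp), fun t => ?_⟩
  rw [← Polynomial.coe_evalRingHom, RingHom.map_det, ContinuousLinearMap.det,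
    ← LinearMap.det_toMatrix b]
  congr 1
  ext i j
  simp [B, Matrix.map_apply, LinearMap.toMatrix_apply, Matrix.one_apply, Finsupp.single_apply,
    add_comm, eq_comm, apply_ite]
  exact mul_comm _ _

theorem integral_det_eq_measure_of_eventually {E : Type*} [NormedAddCommGroup E]
    [NormedSpace ℝ E] [FiniteDimensional ℝ E] [MeasurableSpace E] {μ : MeasureTheory.Measure E}
    {A : E → E →L[ℝ] E} {c δ : ℝ} (hδ : 0 < δ)
    (hint : ∀ t ∈ Ioo 0 δ,
      MeasureTheory.Integrable (fun x => (ContinuousLinearMap.id ℝ E + t • A x).det) μ)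
    (hA : ∀ t ∈ Ioo 0 δ, ∫ x, (ContinuousLinearMap.id ℝ E + t • A x).det ∂μ = c) (s : ℝ) :
    ∫ x, (ContinuousLinearMap.id ℝ E + s • A x).det ∂μ = c := by
  obtain ⟨T, hT, hcard⟩ := (Ioo_infinite hδ).exists_subset_card_eq (Module.finrank ℝ E + 1)
  have hinj : InjOn (id : ℝ → ℝ) T := injOn_id _
  have key (x : E) : (ContinuousLinearMap.id ℝ E + s • A x).det =
      ∑ t ∈ T, (ContinuousLinearMap.id ℝ E + t • A x).det * (Lagrange.basis T id t).eval s := by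
    obtain ⟨p, hp, hpe⟩ := exists_polynomial_eval_eq_det_id_add_smul (A x)
    have hdeg : p.degree < T.card := by
      refine (Polynomial.degree_le_of_natDegree_le hp).trans_lt ?_
      rw [hcard]
      exact_mod_cast Nat.lt_succ_self _
    rw [← hpe, Lagrange.eq_interpolate hinj hdeg, Lagrange.interpolate_apply,
      Polynomial.eval_finsetSum]
    exact Finset.sum_congr rfl fun t _ => by simp [hpe]
  have hone := congrArg (Polynomial.eval s) (Lagrange.sum_basis hinj
    (Finset.card_pos.mp (by omega : 0 < T.card)))
  rw [Polynomial.eval_finsetSum, Polynomial.eval_one] at hone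
  simp_rw [key]
  rw [MeasureTheory.integral_finsetSum _ fun t ht => (hint t (hT ht)).mul_const _]
  simp_rw [MeasureTheory.integral_mul_const]
  rw [Finset.sum_congr rfl fun t ht => by rw [hA t (hT ht)], ← Finset.mul_sum, hone, mul_one]

theorem not_exists_contDiff_retraction_sphere {E : Type*} [NormedAddCommGroup E]
    [InnerProductSpace ℝ E] [FiniteDimensional ℝ E] {r : E → E} (hr : ContDiff ℝ 1 r)
    (hnorm : ∀ x, ‖r x‖ = 1) (hid : ∀ x, ‖x‖ = 1 → r x = x) : False := by
  borelize E
  let B : Set E := Metric.ball 0 1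
  let D : Set E := Metric.closedBall 0 1
  let A : E → E →L[ℝ] E := fun x => fderiv ℝ r x - ContinuousLinearMap.id ℝ E
  have hA : Continuous A := (hr.continuous_fderiv one_ne_zero).sub continuous_const
  obtain ⟨C, hC⟩ := (isCompact_closedBall (0 : E) 1).exists_bound_of_continuousOn hA.continuousOn
  obtain ⟨K, hK0, hCK⟩ : ∃ K : NNReal, 0 < K ∧ C ≤ K :=
    ⟨⟨max C 1, by positivity⟩, lt_of_lt_of_le one_pos (le_max_right C 1), le_max_left _ _⟩
  have hAK (x : E) (hx : x ∈ D) : ‖A x‖ ≤ K := (hC x hx).trans hCK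
  have hder (x : E) : HasFDerivAt (fun x => r x - x) (A x) x :=
    (hr.differentiable one_ne_zero x).hasFDerivAt.sub (hasFDerivAt_id x)
  have hlip : LipschitzWith K (D.indicator fun x => r x - x) :=
    lipschitzWith_indicator_closedBall
      ((convex_closedBall (0 : E) 1).lipschitzOnWith_of_nnnorm_hasFDerivWithin_le
        (fun x _ => (hder x).hasFDerivWithinAt) fun x hx => hAK x hx)
      fun x hx => by rw [hid x hx, sub_self]
  obtain ⟨η, hη, hdet⟩ : ∃ η > 0, ∀ L : E →L[ℝ] E,
      dist L (ContinuousLinearMap.id ℝ E) < η → 0 < L.det := by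
    refine Metric.eventually_nhds_iff.mp
      ((ContinuousLinearMap.continuous_det (E := E)).continuousAt.eventually_const_lt ?_)
    simp [ContinuousLinearMap.det]
  let δ : ℝ := min 1 η / K
  have hK0' : (0 : ℝ) < K := hK0
  have hδ : 0 < δ := by positivity
  have hdetc (t : ℝ) : Continuous fun x => (ContinuousLinearMap.id ℝ E + t • A x).det :=
    ContinuousLinearMap.continuous_det.comp (continuous_const.add (hA.const_smul t))
  have hint (t : ℝ) : MeasureTheory.IntegrableOn
      (fun x => (ContinuousLinearMap.id ℝ E + t • A x).det) B MeasureTheory.volume :=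
    ((hdetc t).continuousOn.integrableOn_compact (isCompact_closedBall 0 1)).mono_set
      Metric.ball_subset_closedBall
  have hsmall (t : ℝ) (ht : t ∈ Ioo 0 δ) :
      ∫ x in B, (ContinuousLinearMap.id ℝ E + t • A x).det = MeasureTheory.volume.real B := by
    have htK : t * K < min 1 η := (lt_div_iff₀ hK0').mp ht.2
    let F : E → E := fun x => x + t • D.indicator (fun x => r x - x) x
    have hbij : Function.Bijective F := by
      refine bijective_id_add_of_lipschitzWith (K := t.toNNReal * K)
        (LipschitzWith.of_dist_le_mul fun x y => ?_) ?_
      · rw [dist_smul₀, Real.norm_of_nonneg ht.1.le, NNReal.coe_mul, Real.coe_toNNReal t ht.1.le,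
          mul_assoc]
        exact mul_le_mul_of_nonneg_left (hlip.dist_le_mul x y) ht.1.le
      · rw [← NNReal.coe_lt_coe, NNReal.coe_mul, Real.coe_toNNReal t ht.1.le]
        exact htK.trans_le (min_le_left _ _)
    have hFB (x : E) (hx : x ∈ B) : F x = x + t • (r x - x) := by
      have hxD : x ∈ D := Metric.ball_subset_closedBall hx
      simp [F, hxD]
    have hFout (x : E) (hx : x ∉ B) : F x = x := by
      by_cases hxD : x ∈ D
      · have : ‖x‖ = 1 := le_antisymm (by simpa [D] using hxD) (by simpa [B] using hx)
        simp [F, hxD, hid x this]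
      · simp [F, hxD]
    have himg : F '' B = B := by
      apply Subset.antisymm
      · rintro _ ⟨x, hx, rfl⟩
        by_contra hFx
        exact hFx ((hbij.1 (hFout _ hFx)).symm ▸ hx : F x ∈ B)
      · intro y hy
        obtain ⟨x, rfl⟩ := hbij.2 y
        refine ⟨x, ?_, rfl⟩
        by_contra hx
        exact hx (hFout x hx ▸ hy)
    have hFder (x : E) (hx : x ∈ B) :
        HasFDerivWithinAt F (ContinuousLinearMap.id ℝ E + t • A x) B x :=
      ((hasFDerivAt_id x).add ((hder x).const_smul t)).hasFDerivWithinAt.congr hFB (hFB x hx)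
    have hvol := MeasureTheory.integral_image_eq_integral_abs_det_fderiv_smul
      MeasureTheory.volume Metric.isOpen_ball.measurableSet hFder hbij.1.injOn (fun _ => (1 : ℝ))
    rw [himg] at hvol
    simp only [smul_eq_mul, mul_one, MeasureTheory.setIntegral_const] at hvol
    rw [hvol]
    refine MeasureTheory.setIntegral_congr_fun Metric.isOpen_ball.measurableSet fun x hx => ?_
    refine (abs_of_pos (hdet _ ?_)).symm
    rw [dist_eq_norm, add_sub_cancel_left, norm_smul, Real.norm_of_nonneg ht.1.le]
    calc t * ‖A x‖ ≤ t * K := by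
          gcongr
          exacts [ht.1.le, hAK x (Metric.ball_subset_closedBall hx)]
      _ < η := htK.trans_le (min_le_right _ _)
  have hconst := integral_det_eq_measure_of_eventually hδ (fun t _ => hint t) hsmall 1
  have hzero (x : E) : (ContinuousLinearMap.id ℝ E + (1 : ℝ) • A x).det = 0 := by
    by_contra hne
    have hsurj : Function.Surjective (fderiv ℝ r x) := by
      have : ContinuousLinearMap.id ℝ E + (1 : ℝ) • A x = fderiv ℝ r x := by simp [A]
      rw [this] at hne
      exact ((fderiv ℝ r x).toContinuousLinearEquivOfDetNeZero hne).surjective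
    obtain ⟨v, hv⟩ := hsurj (r x)
    have hrx := (hr.differentiable one_ne_zero x).hasFDerivAt
    have h1 := hrx.inner ℝ hrx
    have h2 : (fun y => inner ℝ (r y) (r y)) = fun _ => (1 : ℝ) := by
      ext y; simp [hnorm]
    rw [h2] at h1
    have h3 := DFunLike.congr_fun (h1.unique (hasFDerivAt_const (1 : ℝ) x)) v
    simp [hv, hnorm] at h3
  simp only [hzero, MeasureTheory.integral_zero] at hconst
  exact (ENNReal.toReal_pos (Metric.measure_ball_pos _ _ one_pos).ne'
    MeasureTheory.measure_ball_lt_top.ne).ne hconst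

theorem exists_eq_zero_of_norm_sub_le {E : Type*} [NormedAddCommGroup E]
    [InnerProductSpace ℝ E] [FiniteDimensional ℝ E] {f : E → E}
    (hf : ContinuousOn f (Metric.closedBall 0 1))
    (hfid : ∀ x ∈ Metric.closedBall (0 : E) 1, ‖f x - x‖ ≤ 1 / 4) :
    ∃ x ∈ Metric.closedBall (0 : E) 1, f x = 0 := by
  by_contra! h0
  have hcpt : IsCompact (Metric.closedBall (0 : E) 1) := isCompact_closedBall 0 1
  obtain ⟨m, hm, hfm⟩ : ∃ m > 0, ∀ x ∈ Metric.closedBall (0 : E) 1, m ≤ ‖f x‖ := by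
    obtain ⟨x, hx, hmin⟩ := hcpt.exists_isMinOn ⟨0, by simp⟩ hf.norm
    exact ⟨‖f x‖, norm_pos_iff.mpr (h0 x hx), fun y hy => hmin hy⟩
  obtain ⟨g, hg⟩ := ContinuousMap.exists_restrict_eq Metric.isClosed_closedBall
    (⟨_, hf.domRestrict⟩ : C(Metric.closedBall (0 : E) 1, E))
  have hgf (x : E) (hx : x ∈ Metric.closedBall (0 : E) 1) : g x = f x :=
    DFunLike.congr_fun hg ⟨x, hx⟩
  obtain ⟨p, hp, hpg, -⟩ := g.continuous.exists_contDiff_approx 1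
    (continuous_const (y := min m (1 / 4))) fun _ => by positivity
  have hpf (x : E) (hx : x ∈ Metric.closedBall (0 : E) 1) : ‖p x - f x‖ < min m (1 / 4) := by
    rw [← hgf x hx, ← dist_eq_norm]; exact hpg x
  let χ : ContDiffBump (0 : E) := ⟨1 / 2, 3 / 4, by norm_num, by norm_num⟩
  let G : E → E := fun x => x + χ x • (p x - x)
  have hG : ContDiff ℝ 1 G := contDiff_id.add (χ.contDiff.smul (hp.sub contDiff_id))
  have hGout (x : E) (hx : 3 / 4 ≤ ‖x‖) : G x = x := by
    simp [G, χ.zero_of_le_dist (x := x) (by simpa using hx)]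
  have hG0 (x : E) : G x ≠ 0 := by
    rcases le_total ‖x‖ 1 with hx1 | hx1
    · have hxD : x ∈ Metric.closedBall (0 : E) 1 := by simpa using hx1
      have hpfx := hpf x hxD
      rcases le_total ‖x‖ (1 / 2) with hx | hx
      · have : G x = p x := by
          simp [G, χ.one_of_mem_closedBall (mem_closedBall_zero_iff.mpr hx)]
        rw [this]
        intro hpx
        rw [hpx, zero_sub, norm_neg] at hpfx
        exact absurd (hfm x hxD) (not_le.mpr (hpfx.trans_le (min_le_left _ _)))
      · intro hGx
        have h1 : ‖p x - x‖ < 1 / 2 := by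
          calc ‖p x - x‖ = ‖(p x - f x) + (f x - x)‖ := by rw [sub_add_sub_cancel]
            _ ≤ ‖p x - f x‖ + ‖f x - x‖ := norm_add_le _ _
            _ < 1 / 4 + 1 / 4 :=
              add_lt_add_of_lt_of_le (hpfx.trans_le (min_le_right _ _)) (hfid x hxD)
            _ = 1 / 2 := by norm_num
        have h2 : ‖x‖ = χ x * ‖p x - x‖ := by
          rw [eq_neg_of_add_eq_zero_left hGx, norm_neg, norm_smul, Real.norm_of_nonneg χ.nonneg,
            ← eq_neg_of_add_eq_zero_left hGx]
        have h3 : χ x * ‖p x - x‖ ≤ ‖p x - x‖ :=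
          mul_le_of_le_one_left (norm_nonneg _) χ.le_one
        linarith
    · rw [hGout x (by linarith)]
      exact norm_pos_iff.mp (by linarith)
  refine not_exists_contDiff_retraction_sphere (r := fun x => ‖G x‖⁻¹ • G x) ?_ ?_ ?_
  · exact ((hG.norm ℝ hG0).inv fun x => norm_ne_zero_iff.mpr (hG0 x)).smul hG
  · intro x
    rw [norm_smul, norm_inv, norm_norm, inv_mul_cancel₀ (norm_ne_zero_iff.mpr (hG0 x))]
  · intro x hx
    simp [hGout x (by rw [hx]; norm_num), hx]

theorem exists_eq_of_norm_sub_le {E : Type*} [NormedAddCommGroup E]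
    [InnerProductSpace ℝ E] [FiniteDimensional ℝ E] {f : E → E} {y : E} {ε : ℝ} (hε : 0 < ε)
    (hf : ContinuousOn f (Metric.closedBall y ε))
    (hfid : ∀ x ∈ Metric.closedBall y ε, ‖f x - x‖ ≤ ε / 4) :
    ∃ x ∈ Metric.closedBall y ε, f x = y := by
  have hmaps : MapsTo (fun x : E => y + ε • x) (Metric.closedBall 0 1) (Metric.closedBall y ε) := by
    intro x hx
    have hx' : ‖x‖ ≤ 1 := by simpa using hx
    simpa [norm_smul, abs_of_pos hε] using mul_le_of_le_one_right hε.le hx'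
  obtain ⟨x, hx, h⟩ := exists_eq_zero_of_norm_sub_le
    (f := fun x => ε⁻¹ • (f (y + ε • x) - y))
    (((hf.comp (by fun_prop) hmaps).sub continuousOn_const).const_smul _) fun x hx => by
      have : ε⁻¹ • (f (y + ε • x) - y) - x = ε⁻¹ • (f (y + ε • x) - (y + ε • x)) := by
        rw [← sub_sub, smul_sub _ _ (ε • x), inv_smul_smul₀ hε.ne']
      rw [this, norm_smul, norm_inv, Real.norm_of_nonneg hε.le, inv_mul_le_iff₀ hε]
      linarith [hfid _ (hmaps hx)]
  refine ⟨_, hmaps hx, ?_⟩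
  simpa [hε.ne', sub_eq_zero] using h

theorem EuclideanHalfSpace.zero_lt_of_openPartialHomeomorph {X : Type*} [TopologicalSpace X]
    {n : ℕ} [NeZero n] {e e' : OpenPartialHomeomorph X (EuclideanHalfSpace n)} {x : X}
    (hx : x ∈ e.source) (hx' : x ∈ e'.source) (hpos : 0 < (e x).val 0) : 0 < (e' x).val 0 := by
  by_contra hneg
  let I := 𝓡∂ n
  let e₀ : EuclideanSpace ℝ (Fin n) := EuclideanSpace.single 0 1
  let a : EuclideanSpace ℝ (Fin n) → X := fun z => e.symm (I.symm z)
  let b : ℝ × EuclideanSpace ℝ (Fin n) → EuclideanHalfSpace n := fun p =>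
    I.symm (I (e' (a p.2)) + p.1 • e₀)
  let Φ : ℝ × EuclideanSpace ℝ (Fin n) → EuclideanSpace ℝ (Fin n) := fun p => I (e (e'.symm (b p)))
  let good : ℝ × EuclideanSpace ℝ (Fin n) → Prop := fun p =>
    (I.symm p.2 ∈ e.target ∧ a p.2 ∈ e'.source) ∧ b p ∈ e'.target ∧ e'.symm (b p) ∈ e.source
  let y : EuclideanSpace ℝ (Fin n) := I (e x)
  have hrange {z : EuclideanSpace ℝ (Fin n)} (hz : 0 ≤ z 0) : z ∈ range I :=
    (range_modelWithCornersEuclideanHalfSpace n).ge hz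
  have hca {z : EuclideanSpace ℝ (Fin n)} (hz : I.symm z ∈ e.target) : ContinuousAt a z :=
    ContinuousAt.comp (g := e.symm) (e.symm.continuousAt hz) I.continuous_symm.continuousAt
  have hcb {p : ℝ × EuclideanSpace ℝ (Fin n)} (h₁ : I.symm p.2 ∈ e.target)
      (h₂ : a p.2 ∈ e'.source) : ContinuousAt b p := by
    refine I.continuous_symm.continuousAt.comp (ContinuousAt.add ?_ (by fun_prop))
    refine I.continuous.continuousAt.comp ?_
    exact ContinuousAt.comp (g := e') (e'.continuousAt h₂)
      (ContinuousAt.comp (g := a) (hca h₁) continuousAt_snd)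
  have hcs {p : ℝ × EuclideanSpace ℝ (Fin n)} (hp : good p) :
      ContinuousAt (fun p => e'.symm (b p)) p :=
    ContinuousAt.comp (g := e'.symm) (e'.symm.continuousAt hp.2.1) (hcb hp.1.1 hp.1.2)
  have hcΦ {p : ℝ × EuclideanSpace ℝ (Fin n)} (hp : good p) : ContinuousAt Φ p :=
    I.continuous.continuousAt.comp
      (ContinuousAt.comp (g := e) (e.continuousAt hp.2.2) (hcs hp))
  have hgood {p : ℝ × EuclideanSpace ℝ (Fin n)} (hp : good p) : ∀ᶠ q in 𝓝 p, good q := by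
    have h₁ : ∀ᶠ q : ℝ × EuclideanSpace ℝ (Fin n) in 𝓝 p, I.symm q.2 ∈ e.target :=
      (I.continuous_symm.comp continuous_snd).continuousAt.eventually_mem
        (e.open_target.mem_nhds hp.1.1)
    have h₂ : ∀ᶠ q : ℝ × EuclideanSpace ℝ (Fin n) in 𝓝 p, a q.2 ∈ e'.source :=
      (ContinuousAt.comp (g := a) (hca hp.1.1) continuousAt_snd).eventually_mem
        (e'.open_source.mem_nhds hp.1.2)
    exact (h₁.and h₂).and (((hcb hp.1.1 hp.1.2).eventually_mem
      (e'.open_target.mem_nhds hp.2.1)).and ((hcs hp).eventually_mem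
      (e.open_source.mem_nhds hp.2.2)))
  have hb0 (z : EuclideanSpace ℝ (Fin n)) : b (0, z) = e' (a z) := by simp [b]
  have hstart {z : EuclideanSpace ℝ (Fin n)} (h₁ : I.symm z ∈ e.target)
      (h₂ : a z ∈ e'.source) : good (0, z) := by
    refine ⟨⟨h₁, h₂⟩, ?_, ?_⟩
    · rw [hb0]; exact e'.map_source h₂
    · rw [hb0, e'.left_inv h₂]; exact e.map_target h₁
  have hΦ0 {z : EuclideanSpace ℝ (Fin n)} (hz : 0 ≤ z 0) (h₁ : I.symm z ∈ e.target)
      (h₂ : a z ∈ e'.source) :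
      Φ (0, z) = z := by
    simp only [Φ, hb0]
    rw [e'.left_inv h₂, e.right_inv h₁, I.right_inv]
    exact hrange hz
  have hIy : I.symm y = e x := I.left_inv _
  have hay : a y = x := by simp only [a, hIy, e.left_inv hx]
  have hyt : I.symm y ∈ e.target := hIy ▸ e.map_source hx
  have hev : ∀ᶠ z in 𝓝 y, 0 < z 0 ∧ I.symm z ∈ e.target ∧ a z ∈ e'.source := by
    have hcoord : Continuous fun z : EuclideanSpace ℝ (Fin n) => z 0 := by fun_prop
    refine (hcoord.continuousAt.eventually_const_lt hpos).and
      ((I.continuous_symm.continuousAt.eventually_mem (e.open_target.mem_nhds hyt)).and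
      ((hca hyt).eventually_mem (e'.open_source.mem_nhds ?_)))
    rwa [hay]
  obtain ⟨ε, hε, hball⟩ := Metric.nhds_basis_closedBall.eventually_iff.mp hev
  have hsmall : ∀ᶠ t in 𝓝 (0 : ℝ), ∀ z ∈ Metric.closedBall y ε,
      good (t, z) ∧ ‖Φ (t, z) - z‖ < ε / 4 := by
    refine (isCompact_closedBall y ε).eventually_forall_of_forall_eventually fun z hz => ?_
    obtain ⟨hz0, h₁, h₂⟩ := hball hz
    refine (hgood (hstart h₁ h₂)).and ?_
    refine ((hcΦ (hstart h₁ h₂)).sub continuousAt_snd).norm.eventually_lt_const ?_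
    simpa [hΦ0 hz0.le h₁ h₂] using hε
  obtain ⟨t, ht, ht0⟩ := ((hsmall.filter_mono (nhdsWithin_le_nhds (s := Ioi 0))).and
    self_mem_nhdsWithin).exists
  obtain ⟨z, hz, hzy⟩ := exists_eq_of_norm_sub_le (f := fun z => Φ (t, z)) hε
    (fun z hz => (ContinuousAt.comp (g := Φ) (hcΦ (ht z hz).1)
      (Continuous.prodMk_right t).continuousAt).continuousWithinAt) fun z hz => (ht z hz).2.le
  have hg := (ht z hz).1
  have h1 : e'.symm (b (t, z)) = x := e.injOn hg.2.2 hx (I.injective hzy)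
  have h2 : b (t, z) = e' x := by rw [← h1, e'.right_inv hg.2.1]
  have hc0 : 0 < (I (e' (a z)) + t • e₀) 0 := by
    have he₀ : (I (e' (a z)) + t • e₀) 0 = (e' (a z)).val 0 + t := by
      simp [I, e₀]
    rw [he₀]
    exact add_pos_of_nonneg_of_pos (e' (a z)).2 ht0
  have h3 : I (b (t, z)) = I (e' (a z)) + t • e₀ := I.right_inv (hrange hc0.le)
  rw [← h3, h2] at hc0
  exact hneg hc0

theorem exists_nhds_isPreconnected_inter {X : Type*} [TopologicalSpace X] {n : ℕ} [NeZero n]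
    [ChartedSpace (EuclideanHalfSpace n) X] {S : Set X} (hS : (𝓡∂ n).interior X ⊆ S) (x : X) :
    ∃ U ∈ 𝓝 x, IsPreconnected (U ∩ S) ∧ x ∈ closure (U ∩ S) := by
  let e := chartAt (EuclideanHalfSpace n) x
  let I := 𝓡∂ n
  have hx : x ∈ e.source := mem_chart_source _ x
  have hnhds : I.symm ⁻¹' e.target ∈ 𝓝 (I (e x)) :=
    I.continuous_symm.continuousAt.preimage_mem_nhds
      (by rw [I.left_inv]; exact e.open_target.mem_nhds (e.map_source hx))
  obtain ⟨r, hr, hball⟩ := Metric.nhds_basis_ball.mem_iff.mp hnhds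
  let P : Set (EuclideanSpace ℝ (Fin n)) := {z | 0 < z 0}
  let a : EuclideanSpace ℝ (Fin n) → X := fun z => e.symm (I.symm z)
  have hP : P = interior (range I) := (interior_range_modelWithCornersEuclideanHalfSpace n).symm
  have ha : ContinuousOn a (Metric.ball (I (e x)) r) :=
    e.continuousOn_symm.comp I.continuous_symm.continuousOn hball
  have hax : a (I (e x)) = x := by
    simp only [a, I.left_inv, e.left_inv hx]
  let V : Set X := a '' (Metric.ball (I (e x)) r ∩ P)
  let U : Set X := e.source ∩ (fun y => I (e y)) ⁻¹' Metric.ball (I (e x)) r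
  have hU : U ∈ 𝓝 x := Filter.inter_mem (e.open_source.mem_nhds hx)
    ((I.continuous.continuousAt.comp (e.continuousAt hx)).preimage_mem_nhds
      (Metric.ball_mem_nhds _ hr))
  have hVconn : IsPreconnected V := by
    refine IsPreconnected.image ?_ a (ha.mono inter_subset_left)
    refine ((convex_ball _ _).inter ?_).isPreconnected
    rw [hP]
    exact I.convex_range.interior
  have hVU : V ⊆ U ∩ S := by
    rintro _ ⟨z, ⟨hzb, hzP⟩, rfl⟩
    have hzt : I.symm z ∈ e.target := hball hzb
    have hza : a z ∈ e.source := e.map_target hzt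
    have hIz : I (e (a z)) = z := by
      simp only [a, e.right_inv hzt]
      exact I.right_inv (interior_subset (hP ▸ hzP))
    refine ⟨⟨hza, by simpa only [mem_preimage, hIz] using hzb⟩, hS ?_⟩
    change I (chartAt (EuclideanHalfSpace n) (a z) (a z)) ∈ interior (range I)
    rw [← hP]
    refine EuclideanHalfSpace.zero_lt_of_openPartialHomeomorph hza (mem_chart_source _ _) ?_
    change 0 < (I (e (a z))) 0
    rw [hIz]
    exact hzP
  have hUV : U ⊆ closure V := by
    rintro y ⟨hy, hyb⟩
    have hyP : I (e y) ∈ closure P := by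
      rw [hP, I.range_eq_closure_interior.symm]
      exact mem_range_self _
    have hy' : a (I (e y)) = y := by simp only [a, I.left_inv, e.left_inv hy]
    rw [← hy']
    have hcl : I (e y) ∈ closure (Metric.ball (I (e x)) r ∩ P) :=
      Metric.isOpen_ball.inter_closure ⟨hyb, hyP⟩
    exact ((ha _ hyb).mono inter_subset_left).mem_closure_image hcl
  exact ⟨U, hU, hVconn.subset_closure hVU (inter_subset_left.trans hUV),
    closure_mono hVU (hUV (mem_of_mem_nhds hU))⟩

theorem exists_nhds_inter_subset_connectedComponentIn {X : Type*} [TopologicalSpace X]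
    {S : Set X} (hS : ∀ x, ∃ U ∈ 𝓝 x, IsPreconnected (U ∩ S) ∧ x ∈ closure (U ∩ S))
    (x : X) :
    ∃ U ∈ 𝓝 x, (U ∩ S).Nonempty ∧ ∀ s ∈ S, x ∈ closure (connectedComponentIn S s) →
      U ∩ S ⊆ connectedComponentIn S s := by
  obtain ⟨U, hU, hconn, hcl⟩ := hS x
  refine ⟨U, hU, closure_nonempty_iff.mp ⟨x, hcl⟩, fun s _ hxs => ?_⟩
  obtain ⟨y, hyU, hyC⟩ := mem_closure_iff_nhds.mp hxs U hU
  rw [connectedComponentIn_eq hyC]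
  exact hconn.subset_connectedComponentIn ⟨hyU, connectedComponentIn_subset _ _ hyC⟩
    inter_subset_right

theorem closure_connectedComponentIn_eq_connectedComponent {X : Type*} [TopologicalSpace X]
    {S : Set X} (hS : ∀ x, ∃ U ∈ 𝓝 x, IsPreconnected (U ∩ S) ∧ x ∈ closure (U ∩ S))
    {s : X} (hs : s ∈ S) :
    closure (connectedComponentIn S s) = connectedComponent s := by
  have hdense : Dense S := fun x => by
    obtain ⟨U, -, -, hcl⟩ := hS x
    exact closure_mono inter_subset_right hcl
  have hmem : s ∈ closure (connectedComponentIn S s) :=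
    subset_closure (mem_connectedComponentIn hs)
  refine (isPreconnected_connectedComponentIn.closure.subset_connectedComponent hmem).antisymm ?_
  refine IsClopen.connectedComponent_subset ⟨isClosed_closure, ?_⟩ hmem
  refine isOpen_iff_mem_nhds.mpr fun x hx => ?_
  obtain ⟨U, hU, -, hsub⟩ := exists_nhds_inter_subset_connectedComponentIn hS x
  filter_upwards [interior_mem_nhds.mpr hU] with y hy
  exact closure_mono ((inter_subset_inter_left _ interior_subset).trans (hsub s hs hx))
    (hdense.open_subset_closure_inter isOpen_interior hy)

theorem connectedComponent_inter_eq_connectedComponentIn {X : Type*} [TopologicalSpace X]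
    {S : Set X} (hS : ∀ x, ∃ U ∈ 𝓝 x, IsPreconnected (U ∩ S) ∧ x ∈ closure (U ∩ S))
    {s : X} (hs : s ∈ S) :
    connectedComponent s ∩ S = connectedComponentIn S s := by
  rw [← closure_connectedComponentIn_eq_connectedComponent hS hs]
  refine Subset.antisymm ?_ (subset_inter subset_closure (connectedComponentIn_subset _ _))
  rintro y ⟨hy, hyS⟩
  obtain ⟨U, hU, -, hsub⟩ := exists_nhds_inter_subset_connectedComponentIn hS y
  exact hsub s hs hy ⟨mem_of_mem_nhds hU, hyS⟩

theorem exists_mem_connectedComponent_eq {X : Type*} [TopologicalSpace X]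
    {S : Set X} (hS : ∀ x, ∃ U ∈ 𝓝 x, IsPreconnected (U ∩ S) ∧ x ∈ closure (U ∩ S))
    (x : X) :
    ∃ s ∈ S, connectedComponent x = connectedComponent s := by
  obtain ⟨U, hU, hconn, hcl⟩ := hS x
  obtain ⟨s, hs⟩ := closure_nonempty_iff.mp ⟨x, hcl⟩
  exact ⟨s, hs.2, connectedComponent_eq
    (hconn.closure.subset_connectedComponent hcl (subset_closure hs))⟩

theorem Topology.IsEmbedding.image_connectedComponentIn {X Y : Type*} [TopologicalSpace X]
    [TopologicalSpace Y] {f : X → Y} (hf : IsEmbedding f) {S : Set X} {s : X} (hs : s ∈ S) :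
    f '' connectedComponentIn S s = connectedComponentIn (f '' S) (f s) := by
  refine (hf.continuous.continuousOn.image_connectedComponentIn_subset hs).antisymm ?_
  obtain ⟨T, hTS, hT⟩ := subset_image_iff.mp (connectedComponentIn_subset (f '' S) (f s))
  have hsT : s ∈ T := by
    rw [← hf.injective.mem_set_image, hT]
    exact mem_connectedComponentIn (mem_image_of_mem f hs)
  have hTconn : IsPreconnected T := by
    rw [← hf.isInducing.isPreconnected_image, hT]
    exact isPreconnected_connectedComponentIn
  rw [← hT]
  exact image_mono (hTconn.subset_connectedComponentIn hsT hTS)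

/-- Let `Q` be a topological `n`-manifold with boundary (Hausdorff, second countable,
charted over the Euclidean half-space), and let `M ⊆ Q` be a subset which, with the
subspace topology, is itself a topological `n`-manifold with boundary, such that the
image in `Q` of the manifold interior of `M` is contained in the manifold interior of
`Q`.  Then the map sending a connected component `C` of the subspace `M ∩ in(Q)` to
its closure computed in the subspace `M` (regarded as a subset of `Q`), and the map
sending a connected component `D` of `M` to `D ∩ in(Q)`, are well defined and are
mutually inverse bijections between the set of connected components of `M ∩ in(Q)`
and the set of connected components of `M`. -/
theorem components_closure_inverse_bijections (n : ℕ) [NeZero n] (Q : Type*) [TopologicalSpace Q]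
    [T2Space Q] [SecondCountableTopology Q] [ChartedSpace (EuclideanHalfSpace n) Q]
    (M : Set Q) [ChartedSpace (EuclideanHalfSpace n) ↥M]
    (hint : Subtype.val '' ((𝓡∂ n).interior ↥M) ⊆ (𝓡∂ n).interior Q) :
    -- `inQ` is the manifold interior of `Q`
    let inQ : Set Q := (𝓡∂ n).interior Q
    -- closure computed in the subspace `M`, regarded as a subset of `Q`
    let clM : Set Q → Set Q := fun C => Subtype.val '' closure (Subtype.val ⁻¹' C : Set ↥M)
    -- the set of connected components of the subspace `M ∩ in(Q)`, as subsets of `Q`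
    let compsMI : Set (Set Q) := {C | ∃ x ∈ M ∩ inQ, C = connectedComponentIn (M ∩ inQ) x}
    -- the set of connected components of the subspace `M`, as subsets of `Q`
    let compsM : Set (Set Q) := {D | ∃ x ∈ M, D = connectedComponentIn M x}
    (∀ C ∈ compsMI, clM C ∈ compsM) ∧
    (∀ D ∈ compsM, D ∩ inQ ∈ compsMI) ∧
    (∀ C ∈ compsMI, clM C ∩ inQ = C) ∧
    (∀ D ∈ compsM, clM (D ∩ inQ) = D) := by
  intro inQ clM compsMI compsM
  let S : Set ↥M := Subtype.val ⁻¹' inQ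
  have hS : ∀ x : ↥M, ∃ U ∈ 𝓝 x, IsPreconnected (U ∩ S) ∧ x ∈ closure (U ∩ S) :=
    exists_nhds_isPreconnected_inter (image_subset_iff.mp hint)
  have hMI : M ∩ inQ = Subtype.val '' S := (Subtype.image_preimage_coe M inQ).symm
  have himg {s : ↥M} (hs : s ∈ S) :
      connectedComponentIn (M ∩ inQ) s = Subtype.val '' connectedComponentIn S s := by
    rw [hMI, IsEmbedding.subtypeVal.image_connectedComponentIn hs]
  have hM (x : ↥M) : connectedComponentIn M x = Subtype.val '' connectedComponent x :=
    connectedComponentIn_eq_image x.2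
  have hcl {s : ↥M} (hs : s ∈ S) :
      clM (connectedComponentIn (M ∩ inQ) s) = connectedComponentIn M s := by
    simp only [clM]
    rw [himg hs, preimage_image_eq _ Subtype.val_injective,
      closure_connectedComponentIn_eq_connectedComponent hS hs, hM]
  have hinter {s : ↥M} (hs : s ∈ S) :
      connectedComponentIn M s ∩ inQ = connectedComponentIn (M ∩ inQ) s := by
    rw [himg hs, hM, ← connectedComponent_inter_eq_connectedComponentIn hS hs,
      image_inter_preimage]
  have hrep : ∀ D ∈ compsM, ∃ s ∈ S, D = connectedComponentIn M s := by
    rintro _ ⟨x, hx, rfl⟩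
    obtain ⟨s, hs, h⟩ := exists_mem_connectedComponent_eq hS ⟨x, hx⟩
    exact ⟨s, hs, by rw [hM, ← h, ← hM ⟨x, hx⟩]⟩
  refine ⟨?_, ?_, ?_, ?_⟩
  · rintro _ ⟨x, hx, rfl⟩
    exact ⟨x, hx.1, hcl (s := ⟨x, hx.1⟩) hx.2⟩
  · intro D hD
    obtain ⟨s, hs, rfl⟩ := hrep D hD
    exact ⟨s, ⟨s.2, hs⟩, hinter hs⟩
  · rintro _ ⟨x, hx, rfl⟩
    exact (congrArg (· ∩ inQ) (hcl (s := ⟨x, hx.1⟩) hx.2)).trans (hinter (s := ⟨x, hx.1⟩) hx.2)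
  · intro D hD
    obtain ⟨s, hs, rfl⟩ := hrep D hD
    rw [hinter hs, hcl hs]
end
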